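/- For every positive integer h, there exists a constant c(h) > 0 such that for all sufficiently large x, at least c(h)·x of the integers n ≤ x satisfy: φ(n) is (1+1/h)-dense in [h, φ(n)/(h+1)) and λ(n) is (1+1/h)-dense in [h, λ(n)/(h+1)). -/

import Mathlib

open scoped Classical

open Filter

/-- The Carmichael function: the exponent of the unit group `(ℤ/nℤ)ˣ`. -/
noncomputable def carmichael (n : ℕ) : ℕ := Monoid.exponent (ZMod n)ˣ

/-- `n` is `u`-dense in the set `I`. -/
def DenseDivIn (n : ℕ) (u : ℝ) (I : Set ℝ) : Prop :=
  ∀ y ∈ I, ∃ d : ℕ, d ∣ n ∧ y < (d : ℝ) ∧ (d : ℝ) ≤ u * y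

/-- The primes in the interval `(a, b]`. -/
noncomputable def primesIoc (a b : ℕ) : Finset ℕ := (Finset.Ioc a b).filter Nat.Prime

lemma mem_primesIoc {a b p : ℕ} : p ∈ primesIoc a b ↔ (a < p ∧ p ≤ b) ∧ p.Prime := by
  simp [primesIoc]

lemma log_factorial_eq_sum (N : ℕ) :
    Real.log (N.factorial : ℝ) =
      ∑ p ∈ primesIoc 0 N, (padicValNat p N.factorial : ℝ) * Real.log p := by
  have h := Nat.prod_factorization_pow_eq_self (Nat.factorial_ne_zero N)
  conv_lhs => rw [← h]
  rw [Finsupp.prod, Nat.cast_prod, Real.log_prod]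
  · have hs : N.factorial.factorization.support = primesIoc 0 N := by
      ext p
      simp only [Nat.support_factorization, Nat.mem_primeFactors, mem_primesIoc]
      constructor
      · rintro ⟨hp, hd, -⟩
        exact ⟨⟨hp.pos, (hp.dvd_factorial).1 hd⟩, hp⟩
      · rintro ⟨⟨_, h2⟩, hp⟩
        exact ⟨hp, (hp.dvd_factorial).2 h2, Nat.factorial_ne_zero N⟩
    rw [hs]
    refine Finset.sum_congr rfl fun p hp => ?_
    rw [Nat.cast_pow, Real.log_pow, Nat.factorization_def _ (mem_primesIoc.1 hp).2]
  · intro p hp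
    have := Nat.prime_of_mem_primeFactors (by simpa using hp)
    exact_mod_cast (pow_pos this.pos _).ne'

lemma theta_eq_sum_primesIoc (N : ℕ) :
    Chebyshev.theta (N : ℝ) = ∑ p ∈ primesIoc 0 N, Real.log p := by
  simp [Chebyshev.theta, primesIoc]

theorem sum_log_div_prime_le {N : ℕ} (hN : 1 ≤ N) :
    ∑ p ∈ primesIoc 0 N, Real.log p / p ≤ Real.log N + 2 := by
  have hN0 : (0:ℝ) < N := by exact_mod_cast hN
  have h1 : ∑ p ∈ primesIoc 0 N, ((N:ℝ) / p - 1) * Real.log p ≤ Real.log (N.factorial : ℝ) := by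
    rw [log_factorial_eq_sum]
    refine Finset.sum_le_sum fun p hp => ?_
    obtain ⟨⟨h0, hpN⟩, hp⟩ := mem_primesIoc.1 hp
    have : Fact p.Prime := ⟨hp⟩
    refine mul_le_mul_of_nonneg_right ?_ (Real.log_natCast_nonneg p)
    have h2 : N / p ≤ padicValNat p N.factorial := by
      rw [padicValNat_factorial (b := Nat.log p N + 1) (Nat.lt_succ_self _)]
      have : (1:ℕ) ∈ Finset.Ico 1 (Nat.log p N + 1) := by
        simp [Nat.log_pos hp.one_lt hpN]
      calc N / p = N / p ^ 1 := by simp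
        _ ≤ _ := Finset.single_le_sum (f := fun i => N / p ^ i) (fun _ _ => Nat.zero_le _) this
    have h3 : (N:ℝ) / p < (N / p : ℕ) + 1 := by
      have := Nat.lt_floor_add_one ((N:ℝ) / p)
      rwa [Nat.floor_div_natCast, Nat.floor_natCast] at this
    have h4 : ((N / p : ℕ) : ℝ) ≤ padicValNat p N.factorial := by exact_mod_cast h2
    linarith
  have h2 : Real.log (N.factorial : ℝ) ≤ N * Real.log N := by
    rw [← Real.log_pow]
    refine Real.log_le_log (by exact_mod_cast Nat.factorial_pos N) ?_
    exact_mod_cast Nat.factorial_le_pow N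
  have h3 := Chebyshev.theta_le_log4_mul_x hN0.le
  rw [theta_eq_sum_primesIoc] at h3
  have h4 : ∑ p ∈ primesIoc 0 N, ((N:ℝ) / p - 1) * Real.log p =
      N * ∑ p ∈ primesIoc 0 N, Real.log p / p - ∑ p ∈ primesIoc 0 N, Real.log p := by
    rw [Finset.mul_sum, ← Finset.sum_sub_distrib]
    refine Finset.sum_congr rfl fun p _ => by ring
  have h5 : Real.log 4 ≤ 2 := by
    rw [show (4:ℝ) = 2 ^ 2 by norm_num, Real.log_pow]
    have := Real.log_two_lt_d9
    push_cast; linarith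
  have h6 : (N:ℝ) * ∑ p ∈ primesIoc 0 N, Real.log p / p ≤ N * (Real.log N + 2) := by
    nlinarith
  exact le_of_mul_le_mul_left h6 hN0

theorem exists_log_sub_le_sum_log_div_prime :
    ∃ C : ℝ, 0 ≤ C ∧ ∀ N : ℕ, 1 ≤ N →
      Real.log N - C ≤ ∑ p ∈ primesIoc 0 N, Real.log p / p := by
  have hsum : Summable fun n : ℕ => 4 * (1 / (n:ℝ) ^ (3/2 : ℝ)) :=
    (Real.summable_one_div_nat_rpow.2 (by norm_num)).mul_left 4
  refine ⟨1 + ∑' n : ℕ, 4 * (1 / (n:ℝ) ^ (3/2 : ℝ)), ?_, fun N hN => ?_⟩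
  · have : 0 ≤ ∑' n : ℕ, 4 * (1 / (n:ℝ) ^ (3/2 : ℝ)) := tsum_nonneg fun n => by positivity
    linarith
  have hN0 : (0:ℝ) < N := by exact_mod_cast hN
  have h1 : Real.log (N.factorial : ℝ) ≤
      ∑ p ∈ primesIoc 0 N, N * (Real.log p / p + 4 * (1 / (p:ℝ) ^ (3/2 : ℝ))) := by
    rw [log_factorial_eq_sum]
    refine Finset.sum_le_sum fun p hp => ?_
    obtain ⟨⟨h0, hpN⟩, hp⟩ := mem_primesIoc.1 hp
    have : Fact p.Prime := ⟨hp⟩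
    have hp2 : (2:ℝ) ≤ p := by exact_mod_cast hp.two_le
    have h2 : (p - 1) * padicValNat p N.factorial ≤ N := by
      rw [sub_one_mul_padicValNat_factorial]; exact Nat.sub_le _ _
    have h3 : ((p:ℝ) - 1) * padicValNat p N.factorial ≤ N := by
      have : (((p - 1) * padicValNat p N.factorial : ℕ) : ℝ) ≤ N := by exact_mod_cast h2
      rwa [Nat.cast_mul, Nat.cast_sub hp.one_lt.le, Nat.cast_one] at this
    have h4 : (padicValNat p N.factorial : ℝ) ≤ N / (p - 1) := by
      rw [le_div_iff₀ (by linarith)]; linarith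
    have h5 : Real.log p ≤ 2 * (p:ℝ) ^ (1/2 : ℝ) := by
      have := Real.log_le_rpow_div (show (0:ℝ) ≤ p by linarith) (show (0:ℝ) < 1/2 by norm_num)
      linarith
    have hlog : 0 ≤ Real.log p := Real.log_natCast_nonneg p
    have h6 : Real.log p / (p - 1) ≤ Real.log p / p + 4 * (1 / (p:ℝ) ^ (3/2 : ℝ)) := by
      have e : (p:ℝ) ^ (3/2 : ℝ) * (p:ℝ) ^ (1/2 : ℝ) = p ^ 2 := by
        rw [← Real.rpow_add (by linarith)]; norm_num
      have hpos : (0:ℝ) < (p:ℝ) ^ (3/2 : ℝ) := by positivity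
      have : Real.log p / (p - 1) - Real.log p / p = Real.log p / (p * (p - 1)) := by
        have : (p:ℝ) - 1 ≠ 0 := by linarith
        field_simp; ring
      have h7 : Real.log p / (p * (p - 1)) ≤ 4 * (1 / (p:ℝ) ^ (3/2 : ℝ)) := by
        rw [mul_one_div, div_le_div_iff₀ (by nlinarith) hpos]
        nlinarith [mul_le_mul_of_nonneg_right h5 hpos.le]
      linarith
    calc (padicValNat p N.factorial : ℝ) * Real.log p ≤ N / (p - 1) * Real.log p :=
          mul_le_mul_of_nonneg_right h4 hlog
      _ = N * (Real.log p / (p - 1)) := by ring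
      _ ≤ _ := mul_le_mul_of_nonneg_left h6 hN0.le
  have h2 : N * Real.log N - N ≤ Real.log (N.factorial : ℝ) := by
    have h3 : ((N:ℝ) / Real.exp 1) ^ N ≤ N.factorial := by
      have h4 : (N:ℝ) ^ N / N.factorial ≤ Real.exp N := Real.pow_div_factorial_le_exp _ hN0.le N
      rw [div_pow, ← Real.exp_nat_mul, mul_one, div_le_iff₀ (Real.exp_pos _)]
      rw [div_le_iff₀ (by positivity)] at h4
      linarith
    have := Real.log_le_log (by positivity) h3
    rw [Real.log_pow, Real.log_div hN0.ne' (Real.exp_pos _).ne', Real.log_exp] at this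
    linarith
  rw [← Finset.mul_sum, Finset.sum_add_distrib] at h1
  have h3 : ∑ p ∈ primesIoc 0 N, 4 * (1 / (p:ℝ) ^ (3/2 : ℝ)) ≤
      ∑' n : ℕ, 4 * (1 / (n:ℝ) ^ (3/2 : ℝ)) :=
    hsum.sum_le_tsum _ fun n _ => by positivity
  have h4 : (N:ℝ) * (Real.log N - 1) ≤ N * (∑ p ∈ primesIoc 0 N, Real.log p / p +
      ∑ p ∈ primesIoc 0 N, 4 * (1 / (p:ℝ) ^ (3/2 : ℝ))) := by linarith
  have := le_of_mul_le_mul_left h4 hN0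
  linarith

lemma primesIoc_union {a b c : ℕ} (hab : a ≤ b) (hbc : b ≤ c) :
    primesIoc a c = primesIoc a b ∪ primesIoc b c := by
  ext p; simp only [mem_primesIoc, Finset.mem_union]; constructor
  · rintro ⟨⟨h1, h2⟩, h⟩
    rcases le_or_gt p b with h3 | h3 <;> tauto
  · rintro (⟨⟨h1, h2⟩, h⟩ | ⟨⟨h1, h2⟩, h⟩)
    · exact ⟨⟨h1, h2.trans hbc⟩, h⟩
    · exact ⟨⟨hab.trans_lt h1, h2⟩, h⟩

lemma disjoint_primesIoc {a b b' c : ℕ} (h : b ≤ b') : Disjoint (primesIoc a b) (primesIoc b' c) := by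
  rw [Finset.disjoint_left]
  intro p h1 h2
  rw [mem_primesIoc] at h1 h2
  omega

lemma sum_primesIoc_consecutive {a b c : ℕ} (hab : a ≤ b) (hbc : b ≤ c) (f : ℕ → ℝ) :
    ∑ p ∈ primesIoc a c, f p = ∑ p ∈ primesIoc a b, f p + ∑ p ∈ primesIoc b c, f p := by
  rw [primesIoc_union hab hbc, Finset.sum_union (disjoint_primesIoc le_rfl)]

theorem exists_log_sub_log_le_sum_primesIoc :
    ∃ C : ℝ, 0 ≤ C ∧ ∀ u v : ℕ, 1 ≤ u → u ≤ v →
      Real.log v - Real.log u - C ≤ ∑ p ∈ primesIoc u v, Real.log p / p := by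
  obtain ⟨C, hC, h⟩ := exists_log_sub_le_sum_log_div_prime
  refine ⟨C + 2, by linarith, fun u v hu huv => ?_⟩
  have h1 := h v (hu.trans huv)
  have h2 := sum_log_div_prime_le hu
  rw [sum_primesIoc_consecutive (Nat.zero_le u) huv] at h1
  linarith

/-- The total mass of squarefree integers composed of primes up to `W` dominates `log W`. -/
theorem log_le_two_mul_prod_one_add (W : ℕ) :
    Real.log W ≤ 2 * ∏ p ∈ primesIoc 0 W, (1 + 1 / (p:ℝ)) := by
  rcases Nat.eq_zero_or_pos W with rfl | hW
  · simp [primesIoc]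
  have h1 : Real.log W ≤ ∑ n ∈ Finset.Icc 1 W, 1 / (n:ℝ) := by
    have := log_add_one_le_harmonic W
    have h2 : Real.log W ≤ Real.log (W + 1 : ℕ) :=
      Real.log_le_log (by exact_mod_cast hW) (by exact_mod_cast Nat.le_succ W)
    rw [harmonic_eq_sum_Icc] at this
    push_cast at this h2
    simp only [one_div]
    linarith
  have h2 : ∑ k ∈ Finset.Icc 1 W, 1 / (k:ℝ) ^ 2 ≤ 2 := by
    have := sum_Ioc_inv_sq_le_sub (α := ℝ) (k := 1) (n := W) (by norm_num) hW
    have e : Finset.Icc 1 W = insert 1 (Finset.Ioc 1 W) := by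
      ext; simp; omega
    rw [e, Finset.sum_insert (by simp)]
    have h0 : (0:ℝ) ≤ (W:ℝ)⁻¹ := by positivity
    simp only [one_div, Nat.cast_one, one_pow, inv_one] at this ⊢
    linarith
  have key : ∀ n ∈ Finset.Icc 1 W, ∃ x ∈ (primesIoc 0 W).powerset ×ˢ Finset.Icc 1 W,
      x.2 ^ 2 * ∏ p ∈ x.1, p = n := by
    intro n hn
    rw [Finset.mem_Icc] at hn
    obtain ⟨a, b, hab, ha⟩ := Nat.sq_mul_squarefree n
    have ha0 : a ≠ 0 := ha.ne_zero
    have hb0 : b ≠ 0 := by rintro rfl; simp at hab; omega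
    have ha1 : a ≤ n := Nat.le_of_dvd (by omega) ⟨b ^ 2, by rw [← hab]; ring⟩
    have hb1 : b ≤ n := Nat.le_of_dvd (by omega) ⟨b * a, by rw [← hab]; ring⟩
    refine ⟨(a.primeFactors, b), ?_, ?_⟩
    · simp only [Finset.mem_product, Finset.mem_powerset, Finset.mem_Icc]
      refine ⟨fun p hp => ?_, by omega⟩
      rw [Nat.mem_primeFactors] at hp
      exact mem_primesIoc.2 ⟨⟨hp.1.pos, (Nat.le_of_dvd (by omega) hp.2.1).trans (by omega)⟩, hp.1⟩
    · simp only [Nat.prod_primeFactors_of_squarefree ha, hab]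
  choose! g hg1 hg2 using key
  have h3 : ∑ n ∈ Finset.Icc 1 W, 1 / (n:ℝ) ≤
      ∑ x ∈ (primesIoc 0 W).powerset ×ˢ Finset.Icc 1 W, (∏ p ∈ x.1, 1 / (p:ℝ)) * (1 / (x.2:ℝ) ^ 2) := by
    have inj : Set.InjOn g (Finset.Icc 1 W : Finset ℕ) := by
      intro a ha b hb hab
      rw [← hg2 a ha, ← hg2 b hb, hab]
    calc ∑ n ∈ Finset.Icc 1 W, 1 / (n:ℝ)
        = ∑ n ∈ Finset.Icc 1 W, (∏ p ∈ (g n).1, 1 / (p:ℝ)) * (1 / ((g n).2:ℝ) ^ 2) := by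
          refine Finset.sum_congr rfl fun n hn => ?_
          have := congrArg (Nat.cast : ℕ → ℝ) (hg2 n hn)
          push_cast at this
          rw [← this, Finset.prod_div_distrib, Finset.prod_const_one]
          rw [div_mul_div_comm, one_mul, mul_comm]
      _ = ∑ x ∈ (Finset.Icc 1 W).image g, (∏ p ∈ x.1, 1 / (p:ℝ)) * (1 / (x.2:ℝ) ^ 2) :=
          (Finset.sum_image (f := fun x : Finset ℕ × ℕ => (∏ p ∈ x.1, 1 / (p:ℝ)) * (1 / (x.2:ℝ) ^ 2)) inj).symm
      _ ≤ _ := by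
          refine Finset.sum_le_sum_of_subset_of_nonneg ?_ ?_
          · intro x hx
            obtain ⟨n, hn, rfl⟩ := Finset.mem_image.1 hx
            exact hg1 n hn
          · intro x _ _
            exact mul_nonneg (Finset.prod_nonneg fun p _ => by positivity) (by positivity)
  rw [Finset.sum_product] at h3
  simp only [← Finset.mul_sum, ← Finset.sum_mul] at h3
  rw [Finset.prod_one_add]
  have h4 : 0 ≤ ∑ U ∈ (primesIoc 0 W).powerset, ∏ p ∈ U, 1 / (p:ℝ) :=
    Finset.sum_nonneg fun U _ => Finset.prod_nonneg fun p _ => by positivity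
  nlinarith

/-! ### Weighted sums over subsets -/

lemma sum_Icc_prod (P S : Finset ℕ) (hS : S ⊆ P) (f : ℕ → ℝ) :
    ∑ U ∈ Finset.Icc S P, ∏ p ∈ U, f p = (∏ p ∈ S, f p) * ∏ p ∈ P \ S, (1 + f p) := by
  rw [Finset.Icc_eq_image_powerset hS, Finset.sum_image, Finset.prod_one_add, Finset.mul_sum]
  · refine Finset.sum_congr rfl fun U hU => ?_
    rw [Finset.prod_union]
    exact Finset.disjoint_of_subset_right (Finset.mem_powerset.1 hU) Finset.disjoint_sdiff
  · intro U hU V hV h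
    have hU := Finset.mem_powerset.1 (Finset.mem_coe.1 hU)
    have hV := Finset.mem_powerset.1 (Finset.mem_coe.1 hV)
    have aux : ∀ {U : Finset ℕ}, U ⊆ P \ S → (S ∪ U) \ S = U := by
      intro U hU
      rw [Finset.union_sdiff_left]
      exact Finset.sdiff_eq_self_of_disjoint
        (Finset.disjoint_of_subset_left hU Finset.sdiff_disjoint)
    rw [← aux hU, ← aux hV]
    exact congrArg (· \ S) h

lemma filter_superset_powerset (P S : Finset ℕ) :
    P.powerset.filter (S ⊆ ·) = Finset.Icc S P := by
  ext U; simp [and_comm]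

lemma sum_superset_prod_le (P S : Finset ℕ) (hS : S ⊆ P) (f : ℕ → ℝ) (hf : ∀ p ∈ P, 0 ≤ f p) :
    ∑ U ∈ P.powerset.filter (S ⊆ ·), ∏ p ∈ U, f p ≤
      (∏ p ∈ S, f p) * ∏ p ∈ P, (1 + f p) := by
  rw [filter_superset_powerset, sum_Icc_prod P S hS]
  refine mul_le_mul_of_nonneg_left ?_ (Finset.prod_nonneg fun p hp => hf p (hS hp))
  rw [← Finset.prod_sdiff hS]
  refine le_mul_of_one_le_right (Finset.prod_nonneg fun p hp => ?_)
    (Finset.one_le_prod fun p hp => ?_)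
  · have := hf p (Finset.sdiff_subset hp)
    linarith
  · have := hf p (hS hp)
    linarith

lemma sum_powerset_prod_mul_sum (P : Finset ℕ) (f l : ℕ → ℝ) (hf : ∀ p ∈ P, 0 ≤ f p) :
    ∑ U ∈ P.powerset, (∏ p ∈ U, f p) * ∑ p ∈ U, l p =
      (∏ p ∈ P, (1 + f p)) * ∑ p ∈ P, l p * (f p / (1 + f p)) := by
  have h1 : ∀ U ∈ P.powerset, (∏ p ∈ U, f p) * ∑ p ∈ U, l p =
      ∑ p ∈ P, if p ∈ U then l p * ∏ q ∈ U, f q else 0 := by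
    intro U hU
    rw [← Finset.sum_filter, Finset.mul_sum]
    have : P.filter (· ∈ U) = U := by
      ext p; simp only [Finset.mem_filter]
      exact ⟨fun h => h.2, fun h => ⟨Finset.mem_powerset.1 hU h, h⟩⟩
    rw [this]
    exact Finset.sum_congr rfl fun p _ => mul_comm _ _
  rw [Finset.sum_congr rfl h1, Finset.sum_comm, Finset.mul_sum]
  refine Finset.sum_congr rfl fun p hp => ?_
  rw [← Finset.sum_filter, ← Finset.mul_sum]
  have h2 : P.powerset.filter (p ∈ ·) = Finset.Icc {p} P := by
    rw [← filter_superset_powerset]; simp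
  rw [h2, sum_Icc_prod P {p} (by simpa using hp), Finset.prod_singleton,
    ← Finset.mul_prod_erase P (fun p => 1 + f p) hp, Finset.sdiff_singleton_eq_erase]
  have := hf p hp
  field_simp

/-- Markov's inequality for the additive function `∑ p ∈ U, l p` of a random subset `U`. -/
lemma sum_filter_lt_prod_le (P : Finset ℕ) (f l : ℕ → ℝ) (hf : ∀ p ∈ P, 0 ≤ f p)
    (hl : ∀ p ∈ P, 0 ≤ l p) (τ : ℝ) :
    τ * ∑ U ∈ P.powerset.filter (fun U => τ < ∑ p ∈ U, l p), ∏ p ∈ U, f p ≤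
      (∏ p ∈ P, (1 + f p)) * ∑ p ∈ P, l p * (f p / (1 + f p)) := by
  rw [← sum_powerset_prod_mul_sum P f l hf, Finset.mul_sum]
  refine (Finset.sum_le_sum (g := fun U => (∏ p ∈ U, f p) * ∑ p ∈ U, l p) ?_).trans
    (Finset.sum_le_sum_of_subset_of_nonneg (Finset.filter_subset _ _) ?_)
  · intro U hU
    obtain ⟨hU, h⟩ := Finset.mem_filter.1 hU
    have : 0 ≤ ∏ p ∈ U, f p := Finset.prod_nonneg fun p hp => hf p (Finset.mem_powerset.1 hU hp)
    nlinarith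
  · intro U hU _
    exact mul_nonneg (Finset.prod_nonneg fun p hp => hf p (Finset.mem_powerset.1 hU hp))
      (Finset.sum_nonneg fun p hp => hl p (Finset.mem_powerset.1 hU hp))

/-- A random subset `U` of `P` rarely meets a set `T` of large total weight in few points. -/
lemma sum_filter_card_inter_lt_le (P T : Finset ℕ) (hT : T ⊆ P) (f : ℕ → ℝ)
    (hf : ∀ p ∈ P, 0 ≤ f p) (hf1 : ∀ p ∈ P, f p ≤ 1) (N : ℕ) :
    ∑ U ∈ P.powerset.filter (fun U => (U ∩ T).card < N), ∏ p ∈ U, f p ≤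
      2 ^ N * Real.exp (-(∑ p ∈ T, f p) / 4) * ∏ p ∈ P, (1 + f p) := by
  have h1 : ∑ U ∈ P.powerset.filter (fun U => (U ∩ T).card < N), ∏ p ∈ U, f p ≤
      ∑ U ∈ P.powerset, 2 ^ N * ∏ p ∈ U, (f p * if p ∈ T then 1/2 else 1) := by
    refine (Finset.sum_le_sum
      (g := fun U => 2 ^ N * ∏ p ∈ U, (f p * if p ∈ T then (1/2 : ℝ) else 1)) ?_).trans
      (Finset.sum_le_sum_of_subset_of_nonneg (Finset.filter_subset _ _) ?_)
    · intro U hU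
      obtain ⟨hU, h⟩ := Finset.mem_filter.1 hU
      have h0 : 0 ≤ ∏ p ∈ U, f p := Finset.prod_nonneg fun p hp => hf p (Finset.mem_powerset.1 hU hp)
      rw [Finset.prod_mul_distrib]
      have : ∏ p ∈ U, (if p ∈ T then (1/2 : ℝ) else 1) = (1/2) ^ (U ∩ T).card := by
        rw [Finset.prod_ite_mem, Finset.prod_const]
      rw [this]
      have h2 : (1:ℝ) ≤ 2 ^ N * (1/2) ^ (U ∩ T).card := by
        rw [one_div, inv_pow, ← div_eq_mul_inv, le_div_iff₀ (by positivity), one_mul]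
        exact pow_le_pow_right₀ (by norm_num) h.le
      nlinarith
    · intro U hU _
      refine mul_nonneg (by positivity) (Finset.prod_nonneg fun p hp => ?_)
      have := hf p (Finset.mem_powerset.1 hU hp)
      split_ifs <;> linarith
  refine h1.trans ?_
  rw [← Finset.mul_sum, ← Finset.prod_one_add, mul_assoc]
  refine mul_le_mul_of_nonneg_left ?_ (by positivity)
  have h3 : Real.exp (-(∑ p ∈ T, f p) / 4) = ∏ p ∈ P, if p ∈ T then Real.exp (-(f p) / 4) else 1 := by
    rw [Finset.prod_ite_mem, Finset.inter_eq_right.2 hT, ← Real.exp_sum]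
    congr 1
    rw [neg_div, Finset.sum_div, ← Finset.sum_neg_distrib]
    exact Finset.sum_congr rfl fun p _ => (neg_div _ _).symm
  rw [h3, ← Finset.prod_mul_distrib]
  refine Finset.prod_le_prod (fun p hp => ?_) (fun p hp => ?_)
  · have := hf p hp
    split_ifs <;> linarith
  · have h0 := hf p hp
    have h1 := hf1 p hp
    split_ifs
    · have := Real.add_one_le_exp (-(f p) / 4)
      nlinarith
    · linarith

/-! ### Sums of periodic functions -/

lemma sum_range_mul_of_coprime {a b : ℕ} (ha : 0 < a) (hb : 0 < b) (hab : a.Coprime b)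
    (f g : ℕ → ℝ) (hf : ∀ n, f (n % a) = f n) (hg : ∀ n, g (n % b) = g n) :
    ∑ n ∈ Finset.range (a * b), f n * g n =
      (∑ n ∈ Finset.range a, f n) * ∑ n ∈ Finset.range b, g n := by
  rw [Finset.sum_mul_sum, ← Finset.sum_product']
  refine Finset.sum_bij' (fun n _ => (n % a, n % b))
    (fun x _ => (Nat.chineseRemainder hab x.1 x.2 : ℕ)) ?_ ?_ ?_ ?_ ?_
  · intro n _
    simp [Nat.mod_lt _ ha, Nat.mod_lt _ hb]
  · intro x _
    exact Finset.mem_range.2 (Nat.chineseRemainder_lt_mul hab _ _ ha.ne' hb.ne')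
  · intro n hn
    have h := Nat.chineseRemainder_modEq_unique hab (a := n % a) (b := n % b) (z := n)
      (Nat.mod_modEq n a).symm (Nat.mod_modEq n b).symm
    have h1 := Nat.chineseRemainder_lt_mul hab (n % a) (n % b) ha.ne' hb.ne'
    exact (Nat.ModEq.eq_of_lt_of_lt h (Finset.mem_range.1 hn) h1).symm
  · rintro ⟨x, y⟩ hx
    simp only [Finset.mem_product, Finset.mem_range] at hx
    have h := (Nat.chineseRemainder hab x y).2
    refine Prod.ext ?_ ?_
    · exact Eq.trans h.1 (Nat.mod_eq_of_lt hx.1)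
    · exact Eq.trans h.2 (Nat.mod_eq_of_lt hx.2)
  · intro n _
    simp only [hf, hg]

lemma sum_range_prod_primes (F : Finset ℕ) (hF : ∀ p ∈ F, p.Prime) (ψ : ℕ → ℕ → ℝ)
    (hψ : ∀ p ∈ F, ∀ n, ψ p (n % p) = ψ p n) :
    ∑ n ∈ Finset.range (∏ p ∈ F, p), ∏ p ∈ F, ψ p n = ∏ p ∈ F, ∑ n ∈ Finset.range p, ψ p n := by
  induction F using Finset.induction_on with
  | empty => simp
  | insert p F hp ih =>
    have hF' : ∀ q ∈ F, q.Prime := fun q hq => hF q (Finset.mem_insert_of_mem hq)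
    have hpp := hF p (Finset.mem_insert_self p F)
    rw [Finset.prod_insert hp, Finset.prod_insert hp,
      ← ih hF' fun q hq => hψ q (Finset.mem_insert_of_mem hq),
      ← sum_range_mul_of_coprime hpp.pos (Finset.prod_pos fun q hq => (hF' q hq).pos)]
    · exact Finset.sum_congr rfl fun n _ => Finset.prod_insert hp
    · refine Nat.Coprime.prod_right fun q hq => ?_
      rw [Nat.coprime_primes hpp (hF' q hq)]
      rintro rfl; exact hp hq
    · exact hψ p (Finset.mem_insert_self p F)
    · intro n
      refine Finset.prod_congr rfl fun q hq => ?_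
      rw [← hψ q (Finset.mem_insert_of_mem hq), Nat.mod_mod_of_dvd _ (Finset.dvd_prod_of_mem _ hq),
        hψ q (Finset.mem_insert_of_mem hq)]

lemma sum_range_periodic_le {d : ℕ} (hd : 0 < d) (f : ℕ → ℝ) (hf : ∀ n, f (n % d) = f n)
    {M : ℝ} (hM : ∀ n, |f n| ≤ M) (t : ℕ) :
    ∑ n ∈ Finset.range t, f n ≤ t * ((∑ n ∈ Finset.range d, f n) / d) + 2 * (d * M) := by
  set S := ∑ n ∈ Finset.range d, f n
  have hM0 : 0 ≤ M := (abs_nonneg _).trans (hM 0)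
  have h1 : ∀ k r : ℕ, ∑ n ∈ Finset.range (d * k + r), f n = k * S + ∑ n ∈ Finset.range r, f n := by
    intro k r
    have h2 : ∀ k m, f (d * k + m) = f m := fun k m => by
      rw [← hf, Nat.mul_add_mod, hf]
    rw [Finset.sum_range_add]
    congr 1
    · induction k with
      | zero => simp
      | succ k ih =>
        rw [Nat.mul_succ, Finset.sum_range_add, ih]
        simp only [h2]
        push_cast; ring
    · simp only [h2]
  have hSd : |S| ≤ d * M := by
    refine (Finset.abs_sum_le_sum_abs _ _).trans ((Finset.sum_le_sum fun n _ => hM n).trans ?_)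
    simp
  have hr : ∑ n ∈ Finset.range (t % d), f n ≤ d * M := by
    refine (Finset.sum_le_sum fun n _ => (le_abs_self _).trans (hM n)).trans ?_
    rw [Finset.sum_const, Finset.card_range, nsmul_eq_mul]
    exact mul_le_mul_of_nonneg_right (by exact_mod_cast (Nat.mod_lt _ hd).le) hM0
  have ht : ((d * (t / d) + t % d : ℕ) : ℝ) = t := by rw [Nat.div_add_mod]
  have hd0 : (0:ℝ) < d := by exact_mod_cast hd
  have h2 : (t:ℝ) * (S / d) = (t / d : ℕ) * S + (t % d : ℕ) / (d:ℝ) * S := by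
    rw [← ht]; push_cast; field_simp
  have h3 : ((t % d : ℕ):ℝ) / (d:ℝ) ≤ 1 := by
    rw [div_le_one hd0]; exact_mod_cast (Nat.mod_lt _ hd).le
  have h4 : -(d * M) ≤ ((t % d : ℕ):ℝ) / (d:ℝ) * S := by
    have h5 : |((t % d : ℕ):ℝ) / (d:ℝ) * S| ≤ 1 * (d * M) := by
      rw [abs_mul, abs_of_nonneg (by positivity)]
      exact mul_le_mul h3 hSd (abs_nonneg _) zero_le_one
    have := neg_abs_le (((t % d : ℕ):ℝ) / (d:ℝ) * S)
    linarith
  calc ∑ n ∈ Finset.range t, f n = ∑ n ∈ Finset.range (d * (t / d) + t % d), f n := by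
        rw [Nat.div_add_mod]
    _ = (t / d : ℕ) * S + ∑ n ∈ Finset.range (t % d), f n := h1 _ _
    _ ≤ _ := by linarith

/-! ### The Selberg sieve -/

lemma sum_range_orthogonal_le (F F' : Finset ℕ) (P : Finset ℕ) (hF : F ⊆ P) (hF' : F' ⊆ P)
    (hP : ∀ p ∈ P, p.Prime) (χ : ℕ → ℕ → ℝ) (g : ℕ → ℝ)
    (hper : ∀ p ∈ P, ∀ n, χ p (n % p) = χ p n)
    (hmean : ∀ p ∈ P, ∑ n ∈ Finset.range p, χ p n = 0)
    (hvar : ∀ p ∈ P, ∑ n ∈ Finset.range p, χ p n ^ 2 = p / g p)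
    (hbd : ∀ p ∈ P, ∀ n, |χ p n| ≤ p)
    (L : ℕ) (hL : ∏ p ∈ F, p ≤ L) (hL' : ∏ p ∈ F', p ≤ L) (t : ℕ) :
    ∑ n ∈ Finset.range t, (∏ p ∈ F, χ p n) * ∏ p ∈ F', χ p n ≤
      (if F = F' then t / ∏ p ∈ F, g p else 0) + 2 * (L:ℝ) ^ 4 := by
  have hU : ∀ p ∈ F ∪ F', p ∈ P := fun p hp => Finset.union_subset hF hF' hp
  set ψ : ℕ → ℕ → ℝ := fun p n =>
    (if p ∈ F then χ p n else 1) * (if p ∈ F' then χ p n else 1) with hψ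
  have e1 : ∀ n, (∏ p ∈ F, χ p n) * ∏ p ∈ F', χ p n = ∏ p ∈ F ∪ F', ψ p n := by
    intro n
    rw [hψ, Finset.prod_mul_distrib, Finset.prod_ite_mem, Finset.prod_ite_mem,
      Finset.union_inter_cancel_left, Finset.union_inter_cancel_right]
  have hψper : ∀ p ∈ F ∪ F', ∀ n, ψ p (n % p) = ψ p n := by
    intro p hp n
    simp only [hψ, hper p (hU p hp) n]
  have hd : 0 < ∏ p ∈ F ∪ F', p := Finset.prod_pos fun p hp => (hP p (hU p hp)).pos
  have hbF : ∀ G ⊆ P, ∏ p ∈ G, p ≤ L → ∀ n, |∏ p ∈ G, χ p n| ≤ L := by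
    intro G hG hGL n
    rw [Finset.abs_prod]
    refine (Finset.prod_le_prod (fun p _ => abs_nonneg _) fun p hp => hbd p (hG hp) n).trans ?_
    rw [← Nat.cast_prod]
    exact_mod_cast hGL
  have hdL : ((∏ p ∈ F ∪ F', p : ℕ) : ℝ) ≤ (L:ℝ) * L := by
    have h1 : (∏ p ∈ F ∪ F', p) * ∏ p ∈ F ∩ F', p ≤ L * L := by
      rw [Finset.prod_union_inter]; exact Nat.mul_le_mul hL hL'
    have h2 : 1 ≤ ∏ p ∈ F ∩ F', p :=
      Finset.prod_pos fun p hp => (hP p (hF (Finset.inter_subset_left hp))).pos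
    have : ∏ p ∈ F ∪ F', p ≤ L * L := (Nat.le_mul_of_pos_right _ h2).trans h1
    exact_mod_cast this
  have h := sum_range_periodic_le hd (fun n => ∏ p ∈ F ∪ F', ψ p n) (M := (L:ℝ) * L) (fun n => by
    refine Finset.prod_congr rfl fun p hp => ?_
    rw [← hψper p hp, Nat.mod_mod_of_dvd _ (Finset.dvd_prod_of_mem _ hp), hψper p hp]) (fun n => by
      rw [← e1, abs_mul]
      exact mul_le_mul (hbF F hF hL n) (hbF F' hF' hL' n) (abs_nonneg _) (Nat.cast_nonneg _)) t
  simp only [e1]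
  refine h.trans (add_le_add ?_ ?_)
  · rw [sum_range_prod_primes _ (fun p hp => hP p (hU p hp)) ψ hψper]
    split_ifs with hFF
    · subst hFF
      have hsum : ∀ p ∈ F, ∑ n ∈ Finset.range p, ψ p n = p / g p := by
        intro p hp
        rw [← hvar p (hF hp)]
        refine Finset.sum_congr rfl fun n _ => ?_
        simp only [hψ, if_pos hp]; ring
      rw [Finset.union_self, Finset.prod_congr rfl hsum, Finset.prod_div_distrib]
      rw [Finset.union_self] at hd
      have hd' : ((∏ p ∈ F, p : ℕ) : ℝ) ≠ 0 := by exact_mod_cast hd.ne'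
      push_cast at hd' ⊢
      rw [div_right_comm, div_self hd']
      exact le_of_eq (by ring)
    · have : ∃ p ∈ F ∪ F', ∑ n ∈ Finset.range p, ψ p n = 0 := by
        by_contra! hne
        apply hFF
        ext p
        by_contra hp
        have hpU : p ∈ F ∪ F' := by
          rw [Finset.mem_union]; tauto
        refine hne p hpU ?_
        rw [← hmean p (hU p hpU)]
        refine Finset.sum_congr rfl fun n _ => ?_
        simp only [hψ]
        by_cases h1 : p ∈ F <;> by_cases h2 : p ∈ F' <;> simp [h1, h2] <;> tauto
      obtain ⟨p, hp, hp0⟩ := this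
      rw [Finset.prod_eq_zero hp hp0]; simp
  · have : (0:ℝ) ≤ (L:ℝ) * L := by positivity
    nlinarith

theorem selberg_sieve (P : Finset ℕ) (hP : ∀ p ∈ P, p.Prime) (χ : ℕ → ℕ → ℝ) (g : ℕ → ℝ)
    (hg : ∀ p ∈ P, 0 < g p)
    (hper : ∀ p ∈ P, ∀ n, χ p (n % p) = χ p n)
    (hmean : ∀ p ∈ P, ∑ n ∈ Finset.range p, χ p n = 0)
    (hvar : ∀ p ∈ P, ∑ n ∈ Finset.range p, χ p n ^ 2 = p / g p)
    (hbd : ∀ p ∈ P, ∀ n, |χ p n| ≤ p) (L : ℕ) (hL : 1 ≤ L) (t : ℕ) (A : Finset ℕ)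
    (hA : A ⊆ Finset.range t) (hA1 : ∀ n ∈ A, ∀ p ∈ P, χ p n = 1) :
    (A.card : ℝ) ≤
      t / (∑ F ∈ P.powerset.filter (fun F => ∏ p ∈ F, p ≤ L), ∏ p ∈ F, g p) + 2 * (L:ℝ) ^ 4 := by
  set ℱ := P.powerset.filter (fun F => ∏ p ∈ F, p ≤ L) with hℱ
  set G := ∑ F ∈ ℱ, ∏ p ∈ F, g p with hG
  have hmem : ∀ F ∈ ℱ, F ⊆ P ∧ ∏ p ∈ F, p ≤ L := fun F hF => by
    obtain ⟨h1, h2⟩ := Finset.mem_filter.1 hF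
    exact ⟨Finset.mem_powerset.1 h1, h2⟩
  have hgF : ∀ F ∈ ℱ, 0 < ∏ p ∈ F, g p := fun F hF =>
    Finset.prod_pos fun p hp => hg p ((hmem F hF).1 hp)
  have hG0 : 0 < G := Finset.sum_pos hgF ⟨∅, by simp [hℱ, hL]⟩
  set w : ℕ → ℝ := fun n => ∑ F ∈ ℱ, (∏ p ∈ F, g p) * ∏ p ∈ F, χ p n with hw
  have hwA : ∀ n ∈ A, w n = G := by
    intro n hn
    refine Finset.sum_congr rfl fun F hF => ?_
    rw [Finset.prod_congr rfl fun p hp => hA1 n hn p ((hmem F hF).1 hp)]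
    simp
  have h1 : (A.card : ℝ) * G ^ 2 ≤ ∑ n ∈ Finset.range t, w n ^ 2 := by
    calc (A.card : ℝ) * G ^ 2 = ∑ n ∈ A, w n ^ 2 := by
          rw [Finset.sum_congr rfl fun n hn => by rw [hwA n hn]]
          simp
      _ ≤ _ := Finset.sum_le_sum_of_subset_of_nonneg hA fun n _ _ => sq_nonneg _
  have h2 : ∑ n ∈ Finset.range t, w n ^ 2 = ∑ F ∈ ℱ, ∑ F' ∈ ℱ,
      ((∏ p ∈ F, g p) * ∏ p ∈ F', g p) *
        ∑ n ∈ Finset.range t, (∏ p ∈ F, χ p n) * ∏ p ∈ F', χ p n := by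
    simp only [Finset.mul_sum]
    rw [Finset.sum_congr rfl fun F _ => Finset.sum_comm, Finset.sum_comm]
    refine Finset.sum_congr rfl fun n _ => ?_
    rw [hw, sq, Finset.sum_mul_sum]
    refine Finset.sum_congr rfl fun F _ => Finset.sum_congr rfl fun F' _ => by ring
  have h3 : ∑ n ∈ Finset.range t, w n ^ 2 ≤ ∑ F ∈ ℱ, ∑ F' ∈ ℱ,
      ((∏ p ∈ F, g p) * ∏ p ∈ F', g p) *
        ((if F = F' then t / ∏ p ∈ F, g p else 0) + 2 * (L:ℝ) ^ 4) := by
    rw [h2]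
    refine Finset.sum_le_sum fun F hF => Finset.sum_le_sum fun F' hF' => ?_
    exact mul_le_mul_of_nonneg_left (sum_range_orthogonal_le F F' P (hmem F hF).1 (hmem F' hF').1
      hP χ g hper hmean hvar hbd L (hmem F hF).2 (hmem F' hF').2 t)
      (mul_pos (hgF F hF) (hgF F' hF')).le
  have h4 : ∑ F ∈ ℱ, ∑ F' ∈ ℱ, ((∏ p ∈ F, g p) * ∏ p ∈ F', g p) *
        ((if F = F' then t / ∏ p ∈ F, g p else 0) + 2 * (L:ℝ) ^ 4) =
      t * G + 2 * (L:ℝ) ^ 4 * G ^ 2 := by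
    simp only [mul_add, Finset.sum_add_distrib]
    congr 1
    · simp only [mul_ite, mul_zero, Finset.sum_ite_eq]
      rw [hG, Finset.mul_sum]
      refine Finset.sum_congr rfl fun F hF => ?_
      rw [if_pos hF]
      have := (hgF F hF).ne'
      field_simp
    · simp only [← Finset.sum_mul, ← Finset.mul_sum]
      ring
  have h5 : (A.card : ℝ) * G ^ 2 ≤ (t / G + 2 * (L:ℝ) ^ 4) * G ^ 2 := by
    refine (h1.trans (h3.trans h4.le)).trans (le_of_eq ?_)
    field_simp
  exact le_of_mul_le_mul_right h5 (by positivity)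

lemma half_prod_le_sum_filter (P : Finset ℕ) (hP : ∀ p ∈ P, p.Prime) (g : ℕ → ℝ)
    (hg : ∀ p ∈ P, 0 ≤ g p) (L : ℕ) (hL : 1 < L)
    (h : 2 * ∑ p ∈ P, Real.log p * (g p / (1 + g p)) ≤ Real.log L) :
    (∏ p ∈ P, (1 + g p)) / 2 ≤
      ∑ F ∈ P.powerset.filter (fun F => ∏ p ∈ F, p ≤ L), ∏ p ∈ F, g p := by
  have h1 := sum_filter_lt_prod_le P g (fun p => Real.log p) hg
    (fun p _ => Real.log_natCast_nonneg p) (Real.log L)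
  have hZ : 0 ≤ ∏ p ∈ P, (1 + g p) := Finset.prod_nonneg fun p hp => by
    have := hg p hp; linarith
  have hL0 : 0 < Real.log L := Real.log_pos (by exact_mod_cast hL)
  have h2 : P.powerset.filter (fun U : Finset ℕ => Real.log L < ∑ p ∈ U, Real.log (p:ℝ)) =
      P.powerset.filter (fun F => ¬ ∏ p ∈ F, p ≤ L) := by
    refine Finset.filter_congr fun U hU => ?_
    have hU := Finset.mem_powerset.1 hU
    have hpos : ∀ p ∈ U, 0 < p := fun p hp => (hP p (hU hp)).pos
    rw [← Real.log_prod fun p hp => by exact_mod_cast (hpos p hp).ne', not_le,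
      ← Nat.cast_prod, Real.log_lt_log_iff (by exact_mod_cast hL.le)
        (by exact_mod_cast Finset.prod_pos hpos), Nat.cast_lt]
  rw [h2] at h1
  have h3 := Finset.sum_filter_add_sum_filter_not P.powerset (fun F => ∏ p ∈ F, p ≤ L)
    fun F => ∏ p ∈ F, g p
  rw [← Finset.prod_one_add] at h3
  have h4 : ∑ F ∈ P.powerset.filter (fun F => ¬ ∏ p ∈ F, p ≤ L), ∏ p ∈ F, g p ≤
      (∏ p ∈ P, (1 + g p)) / 2 := by
    refine le_of_mul_le_mul_left ?_ hL0
    nlinarith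
  linarith

theorem card_le_of_forall_mod_notMem (P : Finset ℕ) (hP : ∀ p ∈ P, p.Prime) (S : ℕ → Finset ℕ)
    (hS : ∀ p ∈ P, S p ⊆ Finset.range p) (hS0 : ∀ p ∈ P, 0 < (S p).card)
    (hSp : ∀ p ∈ P, (S p).card < p) (L : ℕ) (hL : 1 ≤ L) (t : ℕ) (A : Finset ℕ)
    (hA : A ⊆ Finset.range t) (hA1 : ∀ n ∈ A, ∀ p ∈ P, n % p ∉ S p) :
    (A.card : ℝ) ≤
      t / (∑ F ∈ P.powerset.filter (fun F => ∏ p ∈ F, p ≤ L),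
        ∏ p ∈ F, ((S p).card : ℝ) / (p - (S p).card)) + 2 * (L:ℝ) ^ 4 := by
  have key : ∀ p ∈ P, ∀ a b : ℝ, ∑ n ∈ Finset.range p, (if n ∈ S p then a else b) =
      (S p).card * a + (p - (S p).card) * b := by
    intro p hp a b
    have h1 := Finset.sum_ite_mem (Finset.range p) (S p) (fun _ => a - b)
    have h2 : ∀ n, (if n ∈ S p then a else b) = (if n ∈ S p then a - b else 0) + b := by
      intro n; split_ifs <;> ring
    simp only [h2, Finset.sum_add_distrib, h1, Finset.inter_eq_right.2 (hS p hp)]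
    simp
    ring
  have hmod : ∀ p ∈ P, ∀ n ∈ Finset.range p, n % p = n := fun p _ n hn =>
    Nat.mod_eq_of_lt (Finset.mem_range.1 hn)
  have hc : ∀ p ∈ P, (0:ℝ) < (S p).card := fun p hp => by exact_mod_cast hS0 p hp
  have hc1 : ∀ p ∈ P, (1:ℝ) ≤ (S p).card := fun p hp => by exact_mod_cast hS0 p hp
  have hd : ∀ p ∈ P, (0:ℝ) < p - (S p).card := fun p hp => by
    have : ((S p).card:ℝ) < p := by exact_mod_cast hSp p hp
    linarith
  refine selberg_sieve P hP
    (fun p n => if n % p ∈ S p then 1 - (p:ℝ) / (S p).card else 1) _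
    (fun p hp => div_pos (hc p hp) (hd p hp)) ?_ ?_ ?_ ?_ L hL t A hA ?_
  · intro p _ n
    simp only [Nat.mod_mod]
  · intro p hp
    have := (hc p hp).ne'
    rw [Finset.sum_congr rfl fun n hn => by rw [hmod p hp n hn], key p hp]
    field_simp
    ring
  · intro p hp
    have := (hc p hp).ne'
    have := (hd p hp).ne'
    rw [Finset.sum_congr rfl fun n hn => by rw [hmod p hp n hn, ite_pow], key p hp]
    field_simp
    ring
  · intro p hp n
    have h1 := hc1 p hp
    have h2 := hd p hp
    split_ifs
    · have h3 : (1:ℝ) ≤ p / (S p).card := by rw [le_div_iff₀ (hc p hp)]; linarith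
      have h4 : (p:ℝ) / (S p).card ≤ p := div_le_self (by positivity) h1
      rw [abs_le]; constructor <;> linarith
    · rw [abs_one]; linarith
  · intro n hn p hp
    simp [hA1 n hn p hp]

lemma one_add_sum_le_prod_one_add (s : Finset ℕ) (f : ℕ → ℝ) (hf : ∀ i ∈ s, 0 ≤ f i) :
    1 + ∑ i ∈ s, f i ≤ ∏ i ∈ s, (1 + f i) := by
  induction s using Finset.induction_on with
  | empty => simp
  | insert a s ha ih =>
    rw [Finset.sum_insert ha, Finset.prod_insert ha]
    have h1 := ih fun i hi => hf i (Finset.mem_insert_of_mem hi)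
    have h2 := hf a (Finset.mem_insert_self a s)
    have h3 : 0 ≤ ∑ i ∈ s, f i := Finset.sum_nonneg fun i hi => hf i (Finset.mem_insert_of_mem hi)
    nlinarith

theorem card_primes_sub_one_not_dvd_le (z t : ℕ) (hz : 2 ≤ z) (𝒬 : Finset ℕ)
    (h𝒬 : 𝒬 ⊆ primesIoc 2 z) :
    (((Finset.range t).filter fun n => n.Prime ∧ z < n ∧ ∀ q ∈ 𝒬, ¬ q ∣ n - 1).card : ℝ) ≤
      4 * t / (Real.log z * (1 + ∑ q ∈ 𝒬, 1 / (q:ℝ))) + 2 * (3000 * (z:ℝ) ^ 4) ^ 4 := by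
  set P := primesIoc 0 z with hPdef
  have hP : ∀ p ∈ P, p.Prime := fun p hp => (mem_primesIoc.1 hp).2
  have h𝒬P : 𝒬 ⊆ P := fun q hq => by
    have := mem_primesIoc.1 (h𝒬 hq)
    exact mem_primesIoc.2 ⟨⟨by omega, this.1.2⟩, this.2⟩
  set S : ℕ → Finset ℕ := fun p => if p ∈ 𝒬 then {0, 1} else {0} with hS
  have hS1 : ∀ p, p ∈ 𝒬 → (S p).card = 2 := fun p hp => by simp [hS, hp]
  have hS2 : ∀ p, p ∉ 𝒬 → (S p).card = 1 := fun p hp => by simp [hS, hp]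
  have h𝒬2 : ∀ p ∈ 𝒬, 2 < p := fun p hp => (mem_primesIoc.1 (h𝒬 hp)).1.1
  have hlt : ∀ p ∈ P, (S p).card < p := by
    intro p hp
    by_cases h : p ∈ 𝒬
    · rw [hS1 p h]; exact h𝒬2 p h
    · rw [hS2 p h]; exact (hP p hp).one_lt
  have hpos : ∀ p ∈ P, 0 < (S p).card := by
    intro p hp
    by_cases h : p ∈ 𝒬
    · rw [hS1 p h]; norm_num
    · rw [hS2 p h]; norm_num
  have hle2 : ∀ p, (S p).card ≤ 2 := by
    intro p
    by_cases h : p ∈ 𝒬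
    · rw [hS1 p h]
    · rw [hS2 p h]; norm_num
  have hd : ∀ p ∈ P, (0:ℝ) < p - (S p).card := fun p hp => by
    have : ((S p).card:ℝ) < p := by exact_mod_cast hlt p hp
    linarith
  have hz0 : 0 < z := by omega
  have hz4 : 0 < z ^ 4 := by positivity
  have hlogz : 0 < Real.log z := Real.log_pos (by exact_mod_cast hz)
  have hsieve := card_le_of_forall_mod_notMem P hP S (by
      intro p hp n hn
      have := (hP p hp).two_le
      simp only [hS] at hn
      split_ifs at hn <;> simp at hn <;> rw [Finset.mem_range] <;> omega) hpos hlt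
    (3000 * z ^ 4) (by omega) t
    ((Finset.range t).filter fun n => n.Prime ∧ z < n ∧ ∀ q ∈ 𝒬, ¬ q ∣ n - 1)
    (Finset.filter_subset _ _) (by
      intro n hn p hp
      obtain ⟨-, hn, hzn, hq⟩ := Finset.mem_filter.1 hn
      have hp' := mem_primesIoc.1 hp
      have h0 : n % p ≠ 0 := by
        intro h0
        rcases (Nat.dvd_prime hn).1 (Nat.dvd_of_mod_eq_zero h0) with h | h
        · exact hp'.2.one_lt.ne' h
        · omega
      simp only [hS]
      split_ifs with h
      · have h1 : n % p ≠ 1 := by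
          intro h1
          refine hq p h ((Nat.modEq_iff_dvd' hn.one_lt.le).1 ?_)
          rw [Nat.ModEq, h1, Nat.mod_eq_of_lt hp'.2.one_lt]
        simp [h0, h1]
      · simpa using h0)
  have hhalf := half_prod_le_sum_filter P hP (fun p => ((S p).card : ℝ) / (p - (S p).card))
    (fun p hp => div_nonneg (Nat.cast_nonneg _) (hd p hp).le) (3000 * z ^ 4) (by omega) (by
      have h1 : ∑ p ∈ P, Real.log p * (((S p).card : ℝ) / (p - (S p).card) /
          (1 + ((S p).card : ℝ) / (p - (S p).card))) ≤ ∑ p ∈ P, 2 * (Real.log p / p) := by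
        refine Finset.sum_le_sum fun p hp => ?_
        have h2 : ((S p).card : ℝ) / (p - (S p).card) /
          (1 + ((S p).card : ℝ) / (p - (S p).card)) = (S p).card / p := by
          have := (hd p hp).ne'
          have h3 : (p:ℝ) ≠ 0 := by exact_mod_cast (hP p hp).ne_zero
          have h5 : 1 + ((S p).card : ℝ) / (p - (S p).card) = p / (p - (S p).card) := by
            field_simp
            ring
          rw [h5, div_div_div_cancel_right₀ this]
        rw [h2]
        have h3 : ((S p).card : ℝ) ≤ 2 := by exact_mod_cast hle2 p
        have h4 : 0 ≤ Real.log (p:ℝ) / p := div_nonneg (Real.log_natCast_nonneg p) (by positivity)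
        calc Real.log p * ((S p).card / p) = (S p).card * (Real.log p / p) := by ring
          _ ≤ _ := mul_le_mul_of_nonneg_right h3 h4
      rw [← Finset.mul_sum] at h1
      have h2 := sum_log_div_prime_le (N := z) (by omega)
      have h3 : Real.log ((3000 * z ^ 4 : ℕ) : ℝ) = Real.log 3000 + 4 * Real.log z := by
        push_cast
        rw [Real.log_mul (by norm_num) (by positivity), Real.log_pow]
        norm_num
      have h4 : (8:ℝ) ≤ Real.log 3000 := by
        rw [Real.le_log_iff_exp_le (by norm_num)]
        have := Real.exp_one_lt_d9
        have h5 : Real.exp 8 = Real.exp 1 ^ 8 := by rw [← Real.exp_nat_mul]; norm_num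
        rw [h5]
        refine (pow_le_pow_left₀ (Real.exp_pos _).le this.le 8).trans (by norm_num)
      rw [h3]
      linarith)
  have hprod : Real.log z / 2 * (1 + ∑ q ∈ 𝒬, 1 / (q:ℝ)) ≤
      ∏ p ∈ P, (1 + ((S p).card : ℝ) / (p - (S p).card)) := by
    have h1 : ∏ p ∈ P, ((1 + 1 / (p:ℝ)) * (if p ∈ 𝒬 then 1 + 1 / (p:ℝ) else 1)) ≤
        ∏ p ∈ P, (1 + ((S p).card : ℝ) / (p - (S p).card)) := by
      refine Finset.prod_le_prod (fun p _ => by split_ifs <;> positivity) fun p hp => ?_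
      have h2 := hd p hp
      have h3 : (0:ℝ) < p := by exact_mod_cast (hP p hp).pos
      split_ifs with h
      · rw [hS1 p h] at h2 ⊢
        push_cast at h2 ⊢
        rw [← sub_nonneg]
        have : 1 + 2 / ((p:ℝ) - 2) - (1 + 1 / (p:ℝ)) * (1 + 1 / p) =
            (3 * p + 2) / (p ^ 2 * (p - 2)) := by
          field_simp
          ring
        rw [this]
        positivity
      · rw [hS2 p h] at h2 ⊢
        push_cast at h2 ⊢
        rw [mul_one]
        have : 1 / (p:ℝ) ≤ 1 / (p - 1) := one_div_le_one_div_of_le h2 (by linarith)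
        linarith
    rw [Finset.prod_mul_distrib, Finset.prod_ite_mem, Finset.inter_eq_right.2 h𝒬P] at h1
    refine le_trans ?_ h1
    refine mul_le_mul ?_ (one_add_sum_le_prod_one_add _ _ fun q _ => by positivity) ?_ ?_
    · have := log_le_two_mul_prod_one_add z
      linarith
    · have : 0 ≤ ∑ q ∈ 𝒬, 1 / (q:ℝ) := Finset.sum_nonneg fun q _ => by positivity
      linarith
    · exact Finset.prod_nonneg fun q _ => by positivity
  have hB : 0 < 1 + ∑ q ∈ 𝒬, 1 / (q:ℝ) := by
    have : 0 ≤ ∑ q ∈ 𝒬, 1 / (q:ℝ) := Finset.sum_nonneg fun q _ => by positivity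
    linarith
  refine hsieve.trans (add_le_add ?_ (by push_cast; rfl))
  have h5 := (div_le_div_of_nonneg_right hprod zero_le_two).trans hhalf
  refine (div_le_div_of_nonneg_left (Nat.cast_nonneg t) (by positivity) h5).trans (le_of_eq ?_)
  field_simp
  norm_num

lemma exists_pow_le_lt_succ_pow {k : ℕ} (hk : k ≠ 0) (M : ℕ) :
    ∃ z : ℕ, z ^ k ≤ M ∧ M < (z + 1) ^ k := by
  refine ⟨Nat.findGreatest (fun z => z ^ k ≤ M) M, ?_, ?_⟩
  · exact Nat.findGreatest_spec (P := fun z => z ^ k ≤ M) (Nat.zero_le M) (by simp [hk])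
  · by_contra! h
    have h1 : Nat.findGreatest (fun z => z ^ k ≤ M) M + 1 ≤ M := (Nat.le_self_pow hk _).trans h
    exact absurd (Nat.le_findGreatest (P := fun z => z ^ k ≤ M) h1 h) (by omega)

/-- The primes in `(u, v]` one less than which has a divisor in `𝒬`. -/
noncomputable def shiftedPrimes (𝒬 : Finset ℕ) (u v : ℕ) : Finset ℕ :=
  (primesIoc u v).filter fun p => ∃ q ∈ 𝒬, q ∣ p - 1

lemma sum_dyadic_sub_one_not_dvd_le (M : ℕ) (hM : 10 ^ 140 ≤ M) (𝒬 : Finset ℕ)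
    (h𝒬 : ∀ q ∈ 𝒬, q.Prime ∧ 2 < q ∧ q ^ 20 ≤ M) (hB : 4000 ≤ ∑ q ∈ 𝒬, 1 / (q:ℝ)) :
    ∑ p ∈ (primesIoc M (2 * M)).filter (fun p => ¬ ∃ q ∈ 𝒬, q ∣ p - 1), Real.log p / p ≤
      1 / 4 := by
  obtain ⟨z, hz1, hz2⟩ := exists_pow_le_lt_succ_pow (k := 20) (by norm_num) M
  have hz : 10 ^ 6 ≤ z := by
    by_contra! h
    have : (z + 1) ^ 20 ≤ (10 ^ 7) ^ 20 := Nat.pow_le_pow_left (by omega) 20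
    rw [← pow_mul] at this
    omega
  have hM1 : 1 ≤ M := le_trans (Nat.one_le_pow _ _ (by norm_num)) hM
  have hz2' : 2 ≤ z := le_trans (by norm_num) hz
  have hzM : z ≤ M := (Nat.le_self_pow (by norm_num) z).trans hz1
  have hzR : (10:ℝ) ^ 6 ≤ z := by exact_mod_cast hz
  have hzMR : (z:ℝ) ^ 20 ≤ M := by exact_mod_cast hz1
  have hM1R : (1:ℝ) ≤ M := by exact_mod_cast hM1
  have hM0 : (0:ℝ) < M := one_pos.trans_le hM1R
  have hlogz : 0 < Real.log z := Real.log_pos (by linarith)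
  have h𝒬z : 𝒬 ⊆ primesIoc 2 z := fun q hq => by
    obtain ⟨h1, h2, h3⟩ := h𝒬 q hq
    refine mem_primesIoc.2 ⟨⟨h2, ?_⟩, h1⟩
    exact Nat.lt_succ_iff.1 (lt_of_pow_lt_pow_left₀ 20 (Nat.zero_le _) (h3.trans_lt hz2))
  have hlogM : Real.log (2 * M) ≤ 41 * Real.log z := by
    have h2 : (2 * M : ℝ) ≤ (z:ℝ) ^ 41 := by
      have hzz : z + 1 ≤ z ^ 2 := by
        rw [sq]
        exact (by omega : z + 1 ≤ 2 * z).trans (Nat.mul_le_mul_right z hz2')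
      have h3 : M ≤ (z ^ 2) ^ 20 := hz2.le.trans (Nat.pow_le_pow_left hzz 20)
      have h4 : 2 * M ≤ z * (z ^ 2) ^ 20 := Nat.mul_le_mul hz2' h3
      rw [← pow_mul, ← pow_succ'] at h4
      exact_mod_cast h4
    have := Real.log_le_log (mul_pos two_pos hM0) h2
    rw [Real.log_pow] at this
    exact_mod_cast this
  clear hM hz hz1 hz2 h𝒬
  have h1 := card_primes_sub_one_not_dvd_le z (2 * M + 1) hz2' 𝒬 h𝒬z
  set A := (Finset.range (2 * M + 1)).filter fun n => n.Prime ∧ z < n ∧ ∀ q ∈ 𝒬, ¬ q ∣ n - 1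
  have hsum : ∑ p ∈ (primesIoc M (2 * M)).filter (fun p => ¬ ∃ q ∈ 𝒬, q ∣ p - 1),
      Real.log p / p ≤ A.card * (41 * Real.log z / M) := by
    have hsub : (primesIoc M (2 * M)).filter (fun p => ¬ ∃ q ∈ 𝒬, q ∣ p - 1) ⊆ A := by
      intro p hp
      obtain ⟨hp, hq⟩ := Finset.mem_filter.1 hp
      obtain ⟨⟨hp1, hp2⟩, hp⟩ := mem_primesIoc.1 hp
      push Not at hq
      exact Finset.mem_filter.2 ⟨Finset.mem_range.2 (by omega), hp, by omega, hq⟩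
    refine (Finset.sum_le_card_nsmul _ _ (41 * Real.log z / M) fun p hp => ?_).trans ?_
    · obtain ⟨⟨hp1, hp2⟩, hp⟩ := mem_primesIoc.1 (Finset.mem_filter.1 hp).1
      have hp1' : (M:ℝ) < p := by exact_mod_cast hp1
      have hp2' : (p:ℝ) ≤ 2 * M := by exact_mod_cast hp2
      refine div_le_div₀ (by positivity) ?_ hM0 hp1'.le
      exact (Real.log_le_log (by linarith) hp2').trans hlogM
    · rw [nsmul_eq_mul]
      refine mul_le_mul_of_nonneg_right ?_ (by positivity)
      exact_mod_cast Finset.card_le_card hsub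
  refine hsum.trans ((mul_le_mul_of_nonneg_right h1 (by positivity)).trans ?_)
  rw [add_mul]
  have h5 : 4 * ((2 * M + 1 : ℕ):ℝ) / (Real.log z * (1 + ∑ q ∈ 𝒬, 1 / (q:ℝ))) *
      (41 * Real.log z / M) ≤ 1 / 8 := by
    set T := ∑ q ∈ 𝒬, 1 / (q:ℝ)
    have h6 : 4 * ((2 * M + 1 : ℕ):ℝ) / (Real.log z * (1 + T)) * (41 * Real.log z / M) =
        164 * ((2 * M + 1 : ℕ):ℝ) / ((1 + T) * M) := by
      have : 1 + T ≠ 0 := by linarith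
      field_simp
      norm_num
    have h7 : 4001 * (M:ℝ) ≤ (1 + T) * M := mul_le_mul_of_nonneg_right (by linarith) hM0.le
    rw [h6, div_le_iff₀ (by linarith)]
    push_cast
    linarith
  have h6 : 2 * (3000 * (z:ℝ) ^ 4) ^ 4 * (41 * Real.log z / M) ≤ 1 / 8 := by
    have h7 : Real.log z ≤ z := Real.log_le_self (by linarith)
    have h9 : (0:ℝ) < (z:ℝ) ^ 17 := by positivity
    have h10 : ((10:ℝ) ^ 6) ^ 3 ≤ (z:ℝ) ^ 3 := pow_le_pow_left₀ (by positivity) hzR 3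
    rw [mul_div_assoc', div_le_iff₀ hM0]
    calc 2 * (3000 * (z:ℝ) ^ 4) ^ 4 * (41 * Real.log z)
        ≤ 2 * (3000 * (z:ℝ) ^ 4) ^ 4 * (41 * z) := by gcongr
      _ = (82 * 3000 ^ 4) * (z:ℝ) ^ 17 := by ring
      _ ≤ (1 / 8 * (z:ℝ) ^ 3) * (z:ℝ) ^ 17 := by
        refine mul_le_mul_of_nonneg_right ?_ h9.le
        refine le_trans ?_ (mul_le_mul_of_nonneg_left h10 (by norm_num))
        norm_num
      _ = 1 / 8 * (z:ℝ) ^ 20 := by ring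
      _ ≤ _ := by gcongr
  linarith

lemma sum_sub_one_not_dvd_le (u : ℕ) (hu : 10 ^ 140 ≤ u) (𝒬 : Finset ℕ)
    (h𝒬 : ∀ q ∈ 𝒬, q.Prime ∧ 2 < q ∧ q ^ 20 ≤ u) (hB : 4000 ≤ ∑ q ∈ 𝒬, 1 / (q:ℝ)) (j : ℕ) :
    ∑ p ∈ (primesIoc u (2 ^ j * u)).filter (fun p => ¬ ∃ q ∈ 𝒬, q ∣ p - 1), Real.log p / p ≤
      j / 4 := by
  induction j with
  | zero => simp [primesIoc]
  | succ j ih =>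
    have h1 : u ≤ 2 ^ j * u := Nat.le_mul_of_pos_left _ (by positivity)
    have h2 := sum_dyadic_sub_one_not_dvd_le (2 ^ j * u) (hu.trans h1) 𝒬 (fun q hq =>
      ⟨(h𝒬 q hq).1, (h𝒬 q hq).2.1, (h𝒬 q hq).2.2.trans h1⟩) hB
    rw [pow_succ', mul_assoc]
    rw [Finset.sum_filter] at ih h2 ⊢
    rw [sum_primesIoc_consecutive h1 (by omega)]
    push_cast
    linarith

theorem exists_log_sub_le_sum_shiftedPrimes :
    ∃ C : ℝ, 0 ≤ C ∧ ∀ (u v : ℕ) (𝒬 : Finset ℕ), 10 ^ 140 ≤ u → u ≤ v →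
      (∀ q ∈ 𝒬, q.Prime ∧ 2 < q ∧ q ^ 20 ≤ u) → 4000 ≤ ∑ q ∈ 𝒬, 1 / (q:ℝ) →
      (Real.log v - Real.log u) / 2 - C ≤ Real.log v * ∑ p ∈ shiftedPrimes 𝒬 u v, 1 / (p:ℝ) := by
  obtain ⟨C, hC, h⟩ := exists_log_sub_log_le_sum_primesIoc
  refine ⟨C + 1 / 2, by linarith, fun u v 𝒬 hu huv h𝒬 hB => ?_⟩
  have hu0 : 0 < u := by omega
  have hv0 : 0 < v := by omega
  have hu0' : (0:ℝ) < u := by exact_mod_cast hu0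
  have hv0' : (0:ℝ) < v := by exact_mod_cast hv0
  have hex : ∃ j, v ≤ 2 ^ j * u :=
    ⟨v, Nat.lt_two_pow_self.le.trans (Nat.le_mul_of_pos_right _ hu0)⟩
  have hspec := Nat.find_spec hex
  set j := Nat.find hex with hj
  have hjle : (j:ℝ) / 4 ≤ (Real.log v - Real.log u) / 2 + 1 / 2 := by
    have huv' : Real.log u ≤ Real.log v := Real.log_le_log hu0' (by exact_mod_cast huv)
    rcases Nat.eq_zero_or_pos j with h0 | h0
    · rw [h0]; push_cast; linarith
    · have h1 := Nat.find_min hex (m := j - 1) (by omega)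
      have h2 : (2:ℝ) ^ (j - 1) * u ≤ v := by exact_mod_cast (not_le.1 h1).le
      have h3 := Real.log_le_log (by positivity) h2
      rw [Real.log_mul (by positivity) (by positivity), Real.log_pow] at h3
      have h4 := Real.log_two_gt_d9
      have h5 : ((j - 1 : ℕ):ℝ) = j - 1 := by rw [Nat.cast_sub h0, Nat.cast_one]
      rw [h5] at h3
      have h6 : (1:ℝ) ≤ j := by exact_mod_cast h0
      nlinarith
  have h1 := h u v hu0 huv
  have h2 := sum_sub_one_not_dvd_le u hu 𝒬 h𝒬 hB j
  have h3 : ∑ p ∈ (primesIoc u v).filter (fun p => ¬ ∃ q ∈ 𝒬, q ∣ p - 1), Real.log p / p ≤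
      ∑ p ∈ (primesIoc u (2 ^ j * u)).filter (fun p => ¬ ∃ q ∈ 𝒬, q ∣ p - 1),
        Real.log p / p := by
    refine Finset.sum_le_sum_of_subset_of_nonneg (Finset.filter_subset_filter _ fun p hp => ?_)
      fun p _ _ => div_nonneg (Real.log_natCast_nonneg p) (by positivity)
    obtain ⟨⟨hp1, hp2⟩, hp⟩ := mem_primesIoc.1 hp
    exact mem_primesIoc.2 ⟨⟨hp1, hp2.trans hspec⟩, hp⟩
  have h4 := Finset.sum_filter_add_sum_filter_not (primesIoc u v)
    (fun p => ∃ q ∈ 𝒬, q ∣ p - 1) fun p => Real.log p / (p:ℝ)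
  have h5 : ∑ p ∈ shiftedPrimes 𝒬 u v, Real.log p / p ≤
      Real.log v * ∑ p ∈ shiftedPrimes 𝒬 u v, 1 / (p:ℝ) := by
    rw [Finset.mul_sum]
    refine Finset.sum_le_sum fun p hp => ?_
    obtain ⟨⟨hp1, hp2⟩, hp⟩ := mem_primesIoc.1 (Finset.mem_filter.1 hp).1
    rw [mul_one_div]
    refine div_le_div_of_nonneg_right ?_ (by positivity)
    exact Real.log_le_log (by exact_mod_cast hp.pos) (by exact_mod_cast hp2)
  rw [shiftedPrimes] at h5 ⊢
  linarith

lemma mul_div_eight_le_sum_of_sq (f : ℕ → ℝ) (S : ℕ → ℕ → Finset ℕ) (u0 : ℕ)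
    (hS : ∀ u v w, u ≤ v → v ≤ w → ∑ p ∈ S u w, f p = ∑ p ∈ S u v, f p + ∑ p ∈ S v w, f p)
    (hf : ∀ u v, 0 ≤ ∑ p ∈ S u v, f p)
    (h : ∀ u, u0 ≤ u → 1 / 8 ≤ ∑ p ∈ S u (u ^ 2), f p) (u : ℕ) (hu : u0 ≤ u) (s : ℕ) :
    (s:ℝ) / 8 ≤ ∑ p ∈ S u (u ^ 2 ^ s), f p := by
  induction s with
  | zero => simpa using hf u u
  | succ s ih =>
    have h1 : u ≤ u ^ 2 ^ s := Nat.le_self_pow (by positivity) u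
    have h2 : u ^ 2 ^ (s + 1) = (u ^ 2 ^ s) ^ 2 := by rw [← pow_mul, pow_succ]
    rw [h2, hS u (u ^ 2 ^ s) _ h1 (Nat.le_self_pow (by norm_num) _)]
    have := h _ (hu.trans h1)
    push_cast
    linarith

lemma exists_forall_le_log (C : ℝ) : ∃ u0 : ℕ, ∀ u : ℕ, u0 ≤ u → C ≤ Real.log u :=
  eventually_atTop.1
    ((Real.tendsto_log_atTop.comp tendsto_natCast_atTop_atTop).eventually_ge_atTop C)

lemma exists_div_eight_le_sum_primesIoc :
    ∃ u0 : ℕ, ∀ u, u0 ≤ u → ∀ s : ℕ, (s:ℝ) / 8 ≤ ∑ p ∈ primesIoc u (u ^ 2 ^ s), 1 / (p:ℝ) := by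
  obtain ⟨C, hC, h⟩ := exists_log_sub_log_le_sum_primesIoc
  obtain ⟨u0, hu0⟩ := exists_forall_le_log (4 * C + 1)
  refine ⟨max u0 1, mul_div_eight_le_sum_of_sq _ primesIoc _
    (fun u v w huv hvw => sum_primesIoc_consecutive huv hvw _)
    (fun u v => Finset.sum_nonneg fun _ _ => by positivity) fun u hu => ?_⟩
  have h1 := hu0 u ((le_max_left _ _).trans hu)
  have h2 := h u (u ^ 2) ((le_max_right _ _).trans hu) (Nat.le_self_pow (by norm_num) _)
  have h3 : ∑ p ∈ primesIoc u (u ^ 2), Real.log p / p ≤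
      (2 * Real.log u) * ∑ p ∈ primesIoc u (u ^ 2), 1 / (p:ℝ) := by
    rw [Finset.mul_sum]
    refine Finset.sum_le_sum fun p hp => ?_
    obtain ⟨⟨hp1, hp2⟩, hp⟩ := mem_primesIoc.1 hp
    rw [mul_one_div]
    refine div_le_div_of_nonneg_right ?_ (by positivity)
    have := Real.log_le_log (by exact_mod_cast hp.pos) (Nat.cast_le (α := ℝ).2 hp2)
    push_cast at this
    rwa [Real.log_pow] at this
  push_cast at h2
  rw [Real.log_pow] at h2
  push_cast at h2
  refine le_of_mul_le_mul_left ?_ (by linarith : 0 < 2 * Real.log u)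
  linarith

lemma exists_div_eight_le_sum_shiftedPrimes :
    ∃ u0 : ℕ, ∀ u, u0 ≤ u → ∀ 𝒬 : Finset ℕ, (∀ q ∈ 𝒬, q.Prime ∧ 2 < q ∧ q ^ 20 ≤ u) →
      4000 ≤ ∑ q ∈ 𝒬, 1 / (q:ℝ) → ∀ s : ℕ,
      (s:ℝ) / 8 ≤ ∑ p ∈ shiftedPrimes 𝒬 u (u ^ 2 ^ s), 1 / (p:ℝ) := by
  obtain ⟨C, hC, h⟩ := exists_log_sub_le_sum_shiftedPrimes
  obtain ⟨u0, hu0⟩ := exists_forall_le_log (4 * C + 1)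
  refine ⟨max u0 (10 ^ 140), fun u hu 𝒬 h𝒬 hB s => ?_⟩
  refine mul_div_eight_le_sum_of_sq _ (shiftedPrimes 𝒬) u
    (fun u v w huv hvw => ?_)
    (fun u v => Finset.sum_nonneg fun _ _ => by positivity) (fun v hv => ?_) u le_rfl s
  · rw [shiftedPrimes, shiftedPrimes, shiftedPrimes, Finset.sum_filter, Finset.sum_filter,
      Finset.sum_filter, sum_primesIoc_consecutive huv hvw]
  · have h1 := hu0 v ((le_max_left _ _).trans (hu.trans hv))
    have h2 := h v (v ^ 2) 𝒬 ((le_max_right _ _).trans (hu.trans hv))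
      (Nat.le_self_pow (by norm_num) _)
      (fun q hq => ⟨(h𝒬 q hq).1, (h𝒬 q hq).2.1, (h𝒬 q hq).2.2.trans hv⟩) hB
    push_cast at h2
    rw [Real.log_pow] at h2
    push_cast at h2
    refine le_of_mul_le_mul_left ?_ (by linarith : 0 < 2 * Real.log v)
    linarith

lemma sum_filter_exists_le {ι : Type*} (X : Finset (Finset ℕ)) (s : Finset ι)
    (P : Finset ℕ → Prop) [DecidablePred P] (p : ι → Finset ℕ → Prop)
    [∀ i, DecidablePred (p i)] (f : Finset ℕ → ℝ) (hf : ∀ U ∈ X, 0 ≤ f U)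
    (hP : ∀ U ∈ X, P U → ∃ i ∈ s, p i U) :
    ∑ U ∈ X.filter P, f U ≤ ∑ i ∈ s, ∑ U ∈ X.filter (p i), f U := by
  simp only [Finset.sum_filter]
  rw [Finset.sum_comm]
  refine Finset.sum_le_sum fun U hU => ?_
  have h0 : ∀ i ∈ s, 0 ≤ if p i U then f U else 0 := fun i _ => by
    split_ifs
    · exact hf U hU
    · exact le_rfl
  split_ifs with h
  · obtain ⟨i, hi, hp⟩ := hP U hU h
    calc f U = if p i U then f U else 0 := by rw [if_pos hp]
      _ ≤ _ := Finset.single_le_sum h0 hi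
  · exact Finset.sum_nonneg h0

lemma sum_dvd_sub_one_le (T : Finset ℕ) (b q : ℕ) (hT : T ⊆ primesIoc 0 b) (hq : 0 < q) :
    ∑ p ∈ T.filter (fun p => q ∣ p - 1), 1 / (p:ℝ) ≤ (1 + Real.log b) / q := by
  have hq' : (0:ℝ) < q := by exact_mod_cast hq
  have h1 : ∑ p ∈ T.filter (fun p => q ∣ p - 1), 1 / (p:ℝ) ≤
      ∑ p ∈ T.filter (fun p => q ∣ p - 1), 1 / ((q:ℝ) * ((p - 1) / q : ℕ)) := by
    refine Finset.sum_le_sum fun p hp => ?_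
    obtain ⟨hp, hqp⟩ := Finset.mem_filter.1 hp
    have hp := (mem_primesIoc.1 (hT hp)).2
    obtain ⟨m, hm⟩ := hqp
    have hm0 : 0 < m := by
      rcases Nat.eq_zero_or_pos m with h | h
      · have := hp.two_le
        rw [h] at hm
        omega
      · exact h
    rw [hm, Nat.mul_div_cancel_left m hq]
    have hm0' : (0:ℝ) < m := by exact_mod_cast hm0
    refine one_div_le_one_div_of_le (by positivity) ?_
    have : q * m ≤ p := by omega
    exact_mod_cast this
  have h2 : ∑ p ∈ T.filter (fun p => q ∣ p - 1), 1 / ((q:ℝ) * ((p - 1) / q : ℕ)) ≤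
      ∑ m ∈ Finset.Icc 1 b, 1 / ((q:ℝ) * m) := by
    rw [← Finset.sum_image (s := T.filter (fun p => q ∣ p - 1)) (g := fun p => (p - 1) / q)
      (f := fun m : ℕ => 1 / ((q:ℝ) * m))]
    · refine Finset.sum_le_sum_of_subset_of_nonneg ?_ fun _ _ _ => by positivity
      intro m hm
      obtain ⟨p, hp, rfl⟩ := Finset.mem_image.1 hm
      obtain ⟨hp, hqp⟩ := Finset.mem_filter.1 hp
      obtain ⟨⟨-, hpb⟩, hp⟩ := mem_primesIoc.1 (hT hp)
      refine Finset.mem_Icc.2 ⟨Nat.div_pos (Nat.le_of_dvd ?_ hqp) hq, ?_⟩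
      · have := hp.two_le
        omega
      · exact (Nat.div_le_self _ _).trans (by omega)
    · intro p hp p' hp' h
      obtain ⟨hp, hqp⟩ := Finset.mem_filter.1 (Finset.mem_coe.1 hp)
      obtain ⟨hp', hqp'⟩ := Finset.mem_filter.1 (Finset.mem_coe.1 hp')
      have h3 := (mem_primesIoc.1 (hT hp)).2.pos
      have h4 := (mem_primesIoc.1 (hT hp')).2.pos
      have h5 := Nat.div_mul_cancel hqp
      have h6 := Nat.div_mul_cancel hqp'
      dsimp only at h
      rw [h] at h5
      omega
  refine h1.trans (h2.trans ?_)
  have h3 := harmonic_le_one_add_log b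
  rw [harmonic_eq_sum_Icc] at h3
  push_cast at h3
  rw [div_eq_inv_mul, show ∑ m ∈ Finset.Icc 1 b, 1 / ((q:ℝ) * m) =
    (q:ℝ)⁻¹ * ∑ m ∈ Finset.Icc 1 b, ((m:ℝ))⁻¹ by
      rw [Finset.mul_sum]
      exact Finset.sum_congr rfl fun m _ => by rw [one_div, mul_inv]]
  exact mul_le_mul_of_nonneg_left h3 (by positivity)

/-- Two distinct elements of `U ∩ T` are congruent to `1` modulo `q`. -/
def HasCollisionMod (T : Finset ℕ) (q : ℕ) (U : Finset ℕ) : Prop :=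
  ∃ p ∈ U ∩ T, ∃ p' ∈ U ∩ T, p ≠ p' ∧ q ∣ p - 1 ∧ q ∣ p' - 1

/-- Two distinct elements of `U ∩ T` are congruent to `1` modulo some `q ∈ I`. -/
def HasCollision (I T U : Finset ℕ) : Prop := ∃ q ∈ I, HasCollisionMod T q U

lemma sum_filter_congr_pair_le (P T : Finset ℕ) (b q : ℕ) (hTP : T ⊆ P)
    (hT : T ⊆ primesIoc 0 b) (hq : 0 < q) :
    ∑ U ∈ P.powerset.filter (HasCollisionMod T q), ∏ p ∈ U, 1 / (p:ℝ) ≤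
      ((q:ℝ) ^ 2)⁻¹ * ((1 + Real.log b) ^ 2 * ∏ p ∈ P, (1 + 1 / (p:ℝ))) := by
  have hnn : ∀ U ∈ P.powerset, 0 ≤ ∏ p ∈ U, 1 / (p:ℝ) := fun U _ =>
    Finset.prod_nonneg fun _ _ => by positivity
  have hZ : 0 ≤ ∏ p ∈ P, (1 + 1 / (p:ℝ)) := Finset.prod_nonneg fun _ _ => by positivity
  set D := T.filter (fun p => q ∣ p - 1)
  refine (sum_filter_exists_le _ D.offDiag _
    (fun pp U => {pp.1, pp.2} ⊆ U) _ hnn ?_).trans ?_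
  · rintro U - ⟨p, hp, p', hp', hne, h1, h2⟩
    rw [Finset.mem_inter] at hp hp'
    refine ⟨(p, p'), Finset.mem_offDiag.2 ⟨Finset.mem_filter.2 ⟨hp.2, h1⟩,
      Finset.mem_filter.2 ⟨hp'.2, h2⟩, hne⟩, ?_⟩
    rw [Finset.insert_subset_iff, Finset.singleton_subset_iff]
    exact ⟨hp.1, hp'.1⟩
  have h2 : ∀ pp ∈ D.offDiag,
      ∑ U ∈ P.powerset.filter (fun U => {pp.1, pp.2} ⊆ U), ∏ p ∈ U, 1 / (p:ℝ) ≤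
        (1 / (pp.1:ℝ) * (1 / (pp.2:ℝ))) * ∏ p ∈ P, (1 + 1 / (p:ℝ)) := by
    intro pp hpp
    obtain ⟨ha, hb, hab⟩ := Finset.mem_offDiag.1 hpp
    have hsub : {pp.1, pp.2} ⊆ P := by
      rw [Finset.insert_subset_iff, Finset.singleton_subset_iff]
      exact ⟨hTP (Finset.mem_filter.1 ha).1, hTP (Finset.mem_filter.1 hb).1⟩
    have := sum_superset_prod_le P {pp.1, pp.2} hsub (fun p => 1 / (p:ℝ)) fun p _ => by positivity
    rwa [Finset.prod_pair hab] at this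
  refine (Finset.sum_le_sum h2).trans ?_
  rw [← Finset.sum_mul, ← mul_assoc]
  refine mul_le_mul_of_nonneg_right ?_ hZ
  have h3 : ∑ pp ∈ D.offDiag, (1 / (pp.1:ℝ) * (1 / (pp.2:ℝ))) ≤ (∑ p ∈ D, 1 / (p:ℝ)) ^ 2 := by
    rw [sq, Finset.sum_mul_sum, ← Finset.sum_product']
    refine Finset.sum_le_sum_of_subset_of_nonneg ?_ fun _ _ _ => by positivity
    intro pp hpp
    obtain ⟨ha, hb, hab⟩ := Finset.mem_offDiag.1 hpp
    exact Finset.mem_product.2 ⟨ha, hb⟩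
  refine h3.trans ((pow_le_pow_left₀ (Finset.sum_nonneg fun _ _ => by positivity)
    (sum_dvd_sub_one_le T b q hT hq) 2).trans (le_of_eq ?_))
  rw [div_pow, div_eq_inv_mul]

lemma sum_filter_collision_le (P T : Finset ℕ) (b y z : ℕ) (hTP : T ⊆ P)
    (hT : T ⊆ primesIoc 0 b) (hy : 0 < y) (hyz : y ≤ z) :
    ∑ U ∈ P.powerset.filter (HasCollision (primesIoc y z) T), ∏ p ∈ U, 1 / (p:ℝ) ≤
      (1 + Real.log b) ^ 2 / y * ∏ p ∈ P, (1 + 1 / (p:ℝ)) := by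
  have hnn : ∀ U ∈ P.powerset, 0 ≤ ∏ p ∈ U, 1 / (p:ℝ) := fun U _ =>
    Finset.prod_nonneg fun _ _ => by positivity
  have hZ : 0 ≤ ∏ p ∈ P, (1 + 1 / (p:ℝ)) := Finset.prod_nonneg fun _ _ => by positivity
  refine (sum_filter_exists_le P.powerset (primesIoc y z) (HasCollision (primesIoc y z) T)
    (HasCollisionMod T) _ hnn
    fun U _ h => h).trans ?_
  refine (Finset.sum_le_sum fun q hq => sum_filter_congr_pair_le P T b q hTP hT
    (mem_primesIoc.1 hq).2.pos).trans ?_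
  rw [← Finset.sum_mul, div_eq_inv_mul, mul_assoc]
  refine mul_le_mul_of_nonneg_right ?_ (mul_nonneg (sq_nonneg _) hZ)
  have h4 : ∑ q ∈ primesIoc y z, ((q:ℝ) ^ 2)⁻¹ ≤ ∑ q ∈ Finset.Ioc y z, ((q:ℝ) ^ 2)⁻¹ :=
    Finset.sum_le_sum_of_subset_of_nonneg (Finset.filter_subset _ _) fun _ _ _ => by positivity
  have h5 := sum_Ioc_inv_sq_le_sub (α := ℝ) hy.ne' hyz
  have h6 : (0:ℝ) ≤ (z:ℝ)⁻¹ := by positivity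
  linarith

/-- The elements of `I` dividing `p - 1` for some `p ∈ U`. -/
noncomputable def hitBy (I U : Finset ℕ) : Finset ℕ :=
  I.filter fun q => ∃ p ∈ U, q ∣ p - 1

/-- Sets of primes up to `W` of controlled product hitting at least `N` primes of every interval
`(y i, y (i + 1)]` with `i < J`. -/
noncomputable def richSets (y : ℕ → ℕ) (N J W : ℕ) : Finset (Finset ℕ) :=
  (primesIoc 0 W).powerset.filter fun U =>
    ∏ p ∈ U, p ≤ W ^ 16 ∧ ∀ i < J, N ≤ (hitBy (primesIoc (y i) (y (i + 1))) U).card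

lemma sum_filter_le_add (X : Finset (Finset ℕ)) (P A B : Finset ℕ → Prop)
    [DecidablePred P] [DecidablePred A] [DecidablePred B] (f : Finset ℕ → ℝ)
    (hf : ∀ U ∈ X, 0 ≤ f U) (hP : ∀ U ∈ X, P U → A U ∨ B U) :
    ∑ U ∈ X.filter P, f U ≤ ∑ U ∈ X.filter A, f U + ∑ U ∈ X.filter B, f U := by
  simp only [Finset.sum_filter]
  rw [← Finset.sum_add_distrib]
  refine Finset.sum_le_sum fun U hU => ?_
  have h1 := hf U hU
  have h2 := hP U hU
  by_cases hp : P U <;> by_cases ha : A U <;> by_cases hb : B U <;> simp_all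

lemma card_le_card_hitBy (𝒬 U : Finset ℕ) (a b : ℕ)
    (h : ¬ HasCollision 𝒬 (primesIoc a b) U) :
    (U ∩ shiftedPrimes 𝒬 a b).card ≤ (hitBy 𝒬 U).card := by
  have hex : ∀ p : ℕ, p ∈ U ∩ shiftedPrimes 𝒬 a b → ∃ q ∈ 𝒬, q ∣ p - 1 := fun p hp =>
    (Finset.mem_filter.1 (Finset.mem_inter.1 hp).2).2
  choose! F hF1 hF2 using hex
  refine Finset.card_le_card_of_injOn F (fun p hp => ?_) fun p hp p' hp' hpp => ?_
  · have hp := Finset.mem_coe.1 hp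
    exact Finset.mem_coe.2 (Finset.mem_filter.2
      ⟨hF1 p hp, p, (Finset.mem_inter.1 hp).1, hF2 p hp⟩)
  · have hp := Finset.mem_coe.1 hp
    have hp' := Finset.mem_coe.1 hp'
    by_contra hne
    have hm : ∀ p ∈ U ∩ shiftedPrimes 𝒬 a b, p ∈ U ∩ primesIoc a b := fun p hp =>
      Finset.inter_subset_inter le_rfl (Finset.filter_subset _ _) hp
    exact h ⟨F p, hF1 p hp, p, hm p hp, p', hm p' hp', hne, hF2 p hp, hpp ▸ hF2 p' hp'⟩

lemma prod_le_pow_of_sum_log_le (U : Finset ℕ) (hU : ∀ p ∈ U, 0 < p) (W A : ℕ) (hW : 0 < W)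
    (h : ∑ p ∈ U, Real.log (p:ℝ) ≤ A * Real.log W) : ∏ p ∈ U, p ≤ W ^ A := by
  have h1 : Real.log ((∏ p ∈ U, p : ℕ) : ℝ) ≤ Real.log ((W ^ A : ℕ) : ℝ) := by
    rwa [Nat.cast_prod, Real.log_prod fun p hp => Nat.cast_ne_zero.2 (hU p hp).ne',
      Nat.cast_pow, Real.log_pow]
  have h2 := (Real.log_le_log_iff (Nat.cast_pos.2 (Finset.prod_pos hU))
    (Nat.cast_pos.2 (pow_pos hW A))).1 h1
  exact Nat.cast_le.1 h2

lemma log_div_four_le_sum_richSets (y a b s : ℕ → ℕ) (N J W : ℕ) (hy : ∀ i, 0 < y i)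
    (hmono : ∀ i, y i ≤ y (i + 1)) (hb : ∀ i < J, b i ≤ W)
    (hs : ∀ i < J, (s i : ℝ) / 8 ≤
      ∑ p ∈ shiftedPrimes (primesIoc (y i) (y (i + 1))) (a i) (b i), 1 / (p:ℝ))
    (hsum : ∑ i ∈ Finset.range J, 2 ^ N * Real.exp (-(s i : ℝ) / 32) ≤ 1 / 8)
    (hcol : ∑ i ∈ Finset.range J, (1 + Real.log (b i)) ^ 2 / (y i : ℝ) ≤ 1 / 8)
    (hW : 2 ≤ Real.log W) :
    Real.log W / 4 ≤ ∑ U ∈ richSets y N J W, ∏ p ∈ U, 1 / (p:ℝ) := by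
  set P := primesIoc 0 W with hP
  set Z := ∏ p ∈ P, (1 + 1 / (p:ℝ)) with hZ
  set I : ℕ → Finset ℕ := fun i => primesIoc (y i) (y (i + 1)) with hI
  set S : ℕ → Finset ℕ := fun i => shiftedPrimes (I i) (a i) (b i) with hS
  have hW1 : 1 < W := by
    by_contra! h
    have h2 : (W:ℝ) ≤ 1 := by exact_mod_cast h
    have := Real.log_nonpos (Nat.cast_nonneg W) h2
    linarith
  have hZ0 : 0 ≤ Z := Finset.prod_nonneg fun _ _ => by positivity
  have hnn : ∀ U ∈ P.powerset, 0 ≤ ∏ p ∈ U, 1 / (p:ℝ) := fun U _ =>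
    Finset.prod_nonneg fun _ _ => by positivity
  have hTP : ∀ i < J, primesIoc (a i) (b i) ⊆ P := fun i hi p hp => by
    obtain ⟨⟨h1, h2⟩, h3⟩ := mem_primesIoc.1 hp
    exact mem_primesIoc.2 ⟨⟨h3.pos, h2.trans (hb i hi)⟩, h3⟩
  have hbad1 : ∑ U ∈ P.powerset.filter (fun U : Finset ℕ => 16 * Real.log W <
      ∑ p ∈ U, Real.log (p:ℝ)), ∏ p ∈ U, 1 / (p:ℝ) ≤ Z / 8 := by
    have h1 := sum_filter_lt_prod_le P (fun p => 1 / (p:ℝ)) (fun p => Real.log p)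
      (fun p _ => by positivity) (fun p _ => Real.log_natCast_nonneg p) (16 * Real.log W)
    have h2 : ∑ p ∈ P, Real.log p * (1 / (p:ℝ) / (1 + 1 / (p:ℝ))) ≤ Real.log W + 2 := by
      refine le_trans (Finset.sum_le_sum (g := fun p : ℕ => Real.log p / p) fun p _ => ?_)
        (sum_log_div_prime_le hW1.le)
      rw [div_eq_mul_one_div (Real.log (p:ℝ)) (p:ℝ)]
      refine mul_le_mul_of_nonneg_left (div_le_self (by positivity) ?_)
        (Real.log_natCast_nonneg p)
      have : (0:ℝ) ≤ 1 / p := by positivity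
      linarith
    have h3 : Z * ∑ p ∈ P, Real.log p * (1 / (p:ℝ) / (1 + 1 / (p:ℝ))) ≤
        Z * (2 * Real.log W) := mul_le_mul_of_nonneg_left (by linarith) hZ0
    refine le_of_mul_le_mul_left ?_ (by linarith : 0 < 16 * Real.log W)
    refine (h1.trans h3).trans (le_of_eq (by ring))
  have hbad2 : ∑ U ∈ P.powerset.filter (fun U => ∃ i ∈ Finset.range J, (U ∩ S i).card < N),
      ∏ p ∈ U, 1 / (p:ℝ) ≤ Z / 8 := by
    refine (sum_filter_exists_le _ _ _ (fun i U => (U ∩ S i).card < N) _ hnn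
      fun U _ h => h).trans ?_
    refine (Finset.sum_le_sum (g := fun i => 2 ^ N * Real.exp (-(s i : ℝ) / 32) * Z)
      fun i hi => ?_).trans ?_
    · have hi := Finset.mem_range.1 hi
      refine (sum_filter_card_inter_lt_le P (S i)
        ((Finset.filter_subset _ _).trans (hTP i hi)) (fun p => 1 / (p:ℝ))
        (fun p _ => by positivity) (fun p hp => ?_) N).trans ?_
      · exact div_le_one_of_le₀ (by exact_mod_cast (mem_primesIoc.1 hp).2.one_lt.le)
          (by positivity)
      · refine mul_le_mul_of_nonneg_right ?_ hZ0
        refine mul_le_mul_of_nonneg_left (Real.exp_le_exp.2 ?_) (by positivity)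
        have := hs i hi
        linarith
    · rw [← Finset.sum_mul]
      refine (mul_le_mul_of_nonneg_right hsum hZ0).trans (le_of_eq (by ring))
  have hbad3 : ∑ U ∈ P.powerset.filter (fun U => ∃ i ∈ Finset.range J,
      HasCollision (I i) (primesIoc (a i) (b i)) U), ∏ p ∈ U, 1 / (p:ℝ) ≤ Z / 8 := by
    refine (sum_filter_exists_le _ _ _ (fun i U => HasCollision (I i) (primesIoc (a i) (b i)) U) _ hnn fun U _ h => h).trans ?_
    refine (Finset.sum_le_sum (g := fun i => (1 + Real.log (b i)) ^ 2 / (y i : ℝ) * Z)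
      fun i hi => ?_).trans ?_
    · have hi := Finset.mem_range.1 hi
      refine sum_filter_collision_le P _ (b i) _ _ (hTP i hi) (fun p hp => ?_) (hy i) (hmono i)
      obtain ⟨⟨h1, h2⟩, h3⟩ := mem_primesIoc.1 hp
      exact mem_primesIoc.2 ⟨⟨h3.pos, h2⟩, h3⟩
    · rw [← Finset.sum_mul]
      refine (mul_le_mul_of_nonneg_right hcol hZ0).trans (le_of_eq (by ring))
  set good : Finset ℕ → Prop := fun U =>
    ∏ p ∈ U, p ≤ W ^ 16 ∧ ∀ i < J, N ≤ (hitBy (I i) U).card with hgood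
  have h1 := Finset.sum_filter_add_sum_filter_not P.powerset good fun U => ∏ p ∈ U, 1 / (p:ℝ)
  rw [← Finset.prod_one_add] at h1
  have h2 := sum_filter_le_add P.powerset (fun U => ¬ good U)
    (fun U : Finset ℕ => 16 * Real.log W < ∑ p ∈ U, Real.log (p:ℝ))
    (fun U => (∃ i ∈ Finset.range J, (U ∩ S i).card < N) ∨
      ∃ i ∈ Finset.range J, HasCollision (I i) (primesIoc (a i) (b i)) U)
    (fun U => ∏ p ∈ U, 1 / (p:ℝ)) hnn (by
      intro U hU hbad
      by_contra! hcon
      obtain ⟨h1, h2, h3⟩ := hcon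
      have hUP := Finset.mem_powerset.1 hU
      have hpos : ∀ p ∈ U, 0 < p := fun p hp => (mem_primesIoc.1 (hUP hp)).2.pos
      refine hbad ⟨?_, fun i hi => ?_⟩
      · exact prod_le_pow_of_sum_log_le U hpos W 16 (Nat.zero_lt_of_lt hW1) (by push_cast; exact h1)
      · exact (h2 i (Finset.mem_range.2 hi)).trans
          (card_le_card_hitBy _ _ _ _ (h3 i (Finset.mem_range.2 hi))))
  have h3 := sum_filter_le_add P.powerset
    (fun U => (∃ i ∈ Finset.range J, (U ∩ S i).card < N) ∨
      ∃ i ∈ Finset.range J, HasCollision (I i) (primesIoc (a i) (b i)) U)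
    (fun U => ∃ i ∈ Finset.range J, (U ∩ S i).card < N)
    (fun U => ∃ i ∈ Finset.range J, HasCollision (I i) (primesIoc (a i) (b i)) U)
    (fun U => ∏ p ∈ U, 1 / (p:ℝ)) hnn fun U _ h => h
  have h4 := log_le_two_mul_prod_one_add W
  have h5 : ∑ U ∈ richSets y N J W, ∏ p ∈ U, 1 / (p:ℝ) =
    ∑ U ∈ P.powerset.filter good, ∏ p ∈ U, 1 / (p:ℝ) := rfl
  rw [h5]
  linarith

lemma sum_range_pow_le {r : ℝ} (hr : 0 ≤ r) (hr1 : r < 1) (n : ℕ) :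
    ∑ i ∈ Finset.range n, r ^ i ≤ (1 - r)⁻¹ := by
  rw [← tsum_geometric_of_lt_one hr hr1]
  exact (summable_geometric_of_lt_one hr hr1).sum_le_tsum _ fun i _ => pow_nonneg hr i

lemma exists_sum_exp_min_le (N : ℕ) : ∃ s0 : ℕ, ∀ J : ℕ, ∑ i ∈ Finset.range J,
    2 ^ N * Real.exp (-((min (s0 + i) (s0 + (J - i)) : ℕ) : ℝ) / 32) ≤ 1 / 8 := by
  set r := Real.exp (-1 / 32) with hr
  have hr0 : 0 < r := Real.exp_pos _
  have hr1 : r < 1 := by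
    rw [hr, ← Real.exp_zero]
    exact Real.exp_lt_exp.2 (by norm_num)
  have hpow : ∀ n : ℕ, Real.exp (-(n:ℝ) / 32) = r ^ n := fun n => by
    rw [hr, ← Real.exp_nat_mul]
    congr 1
    ring
  have hlim : Tendsto (fun s : ℕ => 2 ^ N * (2 * (1 - r)⁻¹) * r ^ s) atTop (nhds 0) := by
    have := (tendsto_pow_atTop_nhds_zero_of_lt_one hr0.le hr1).const_mul
      (2 ^ N * (2 * (1 - r)⁻¹))
    rwa [mul_zero] at this
  obtain ⟨s0, hs0⟩ := (hlim.eventually_le_const (by norm_num : (0:ℝ) < 1 / 8)).exists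
  refine ⟨s0, fun J => ?_⟩
  have h1 : ∀ i ∈ Finset.range J,
      2 ^ N * Real.exp (-((min (s0 + i) (s0 + (J - i)) : ℕ) : ℝ) / 32) ≤
      2 ^ N * r ^ s0 * (r ^ i + r ^ (J - 1 - i)) := by
    intro i hi
    have hi := Finset.mem_range.1 hi
    rw [hpow, mul_assoc]
    refine mul_le_mul_of_nonneg_left ?_ (by positivity)
    have h2 : r ^ (J - i) ≤ r ^ (J - 1 - i) :=
      pow_le_pow_of_le_one hr0.le hr1.le (by omega)
    have h3 : 0 ≤ r ^ i := by positivity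
    have h4 : 0 ≤ r ^ (J - 1 - i) := by positivity
    have h5 : 0 ≤ r ^ s0 := by positivity
    rcases min_choice (s0 + i) (s0 + (J - i)) with h | h
    · rw [h, pow_add]
      exact mul_le_mul_of_nonneg_left (by linarith) h5
    · rw [h, pow_add]
      exact mul_le_mul_of_nonneg_left (by linarith) h5
  refine (Finset.sum_le_sum h1).trans (le_trans ?_ hs0)
  rw [← Finset.mul_sum, Finset.sum_add_distrib, Finset.sum_range_reflect (fun i => r ^ i) J]
  have h2 := sum_range_pow_le hr0.le hr1 J
  calc 2 ^ N * r ^ s0 * (∑ i ∈ Finset.range J, r ^ i + ∑ i ∈ Finset.range J, r ^ i)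
      ≤ 2 ^ N * r ^ s0 * ((1 - r)⁻¹ + (1 - r)⁻¹) :=
        mul_le_mul_of_nonneg_left (by linarith) (by positivity)
    _ = _ := by ring

lemma exists_sum_sq_log_div_le (R : ℕ) (hR : 2 ≤ R) (C : ℝ) (hC : 0 ≤ C) :
    ∃ Y0 : ℕ, ∀ Y : ℕ, Y0 ≤ Y → ∀ J : ℕ, ∑ i ∈ Finset.range J,
      (1 + C * (2 * R) ^ i * Real.log Y) ^ 2 / ((Y ^ R ^ i : ℕ) : ℝ) ≤ 1 / 8 := by
  have hlim : Tendsto (fun Y : ℕ => (1 + C) ^ 2 * (Real.log Y ^ 2 / Y)) atTop (nhds 0) := by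
    have h1 := (Real.isLittleO_pow_log_id_atTop (n := 2)).tendsto_div_nhds_zero
    have h2 := (h1.comp tendsto_natCast_atTop_atTop).const_mul ((1 + C) ^ 2)
    rw [mul_zero] at h2
    exact h2
  obtain ⟨Y1, hY1⟩ := exists_forall_le_log 1
  obtain ⟨Y2, hY2⟩ := eventually_atTop.1
    (hlim.eventually_le_const (by norm_num : (0:ℝ) < 1 / 16))
  refine ⟨max (max Y1 Y2) (8 * R ^ 2 + 1), fun Y hY J => ?_⟩
  have hYa := hY1 Y ((le_max_left _ _).trans ((le_max_left _ _).trans hY))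
  have hYb := hY2 Y ((le_max_right _ _).trans ((le_max_left _ _).trans hY))
  have hYc : 8 * R ^ 2 + 1 ≤ Y := (le_max_right _ _).trans hY
  have hY0 : 0 < Y := by omega
  have hY0' : (0:ℝ) < Y := by exact_mod_cast hY0
  have hterm : ∀ i ∈ Finset.range J,
      (1 + C * (2 * R) ^ i * Real.log Y) ^ 2 / ((Y ^ R ^ i : ℕ) : ℝ) ≤
      1 / 16 * (1 / 2) ^ i := by
    intro i _
    have h2R : (1:ℝ) ≤ (2 * R) ^ i := by
      refine one_le_pow₀ ?_
      have : (2:ℝ) ≤ R := by exact_mod_cast hR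
      linarith
    have h1 : 1 + C * (2 * R) ^ i * Real.log Y ≤ (2 * R) ^ i * ((1 + C) * Real.log Y) := by
      nlinarith [mul_le_mul h2R hYa zero_le_one (by linarith)]
    have h0 : 0 ≤ 1 + C * (2 * R) ^ i * Real.log Y := by
      have : 0 ≤ C * (2 * R) ^ i * Real.log Y := by positivity
      linarith
    have h2 : (1 + C * (2 * R) ^ i * Real.log Y) ^ 2 ≤
        ((1 + C) ^ 2 * Real.log Y ^ 2) * (4 * R ^ 2) ^ i := by
      refine (pow_le_pow_left₀ h0 h1 2).trans (le_of_eq ?_)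
      rw [mul_pow _ ((1 + C) * Real.log Y), ← pow_mul, mul_comm i 2, pow_mul, mul_pow (1 + C),
        mul_comm]
      congr 2
      ring
    have h3 : (Y:ℝ) ^ (i + 1) ≤ ((Y ^ R ^ i : ℕ) : ℝ) := by
      have : Y ^ (i + 1) ≤ Y ^ R ^ i := Nat.pow_le_pow_right hY0 (Nat.lt_pow_self hR)
      exact_mod_cast this
    have h4 : (4 * (R:ℝ) ^ 2) ^ i ≤ (Y:ℝ) ^ i * (1 / 2) ^ i := by
      rw [← mul_pow]
      refine pow_le_pow_left₀ (by positivity) ?_ i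
      have : (8 * R ^ 2 + 1 : ℝ) ≤ Y := by exact_mod_cast hYc
      linarith
    have h5 : (1 + C) ^ 2 * Real.log Y ^ 2 ≤ 1 / 16 * Y := by
      rwa [← mul_div_assoc, div_le_iff₀ hY0'] at hYb
    rw [div_le_iff₀ (by positivity)]
    calc (1 + C * (2 * R) ^ i * Real.log Y) ^ 2
        ≤ ((1 + C) ^ 2 * Real.log Y ^ 2) * (4 * R ^ 2) ^ i := h2
      _ ≤ (1 / 16 * Y) * ((Y:ℝ) ^ i * (1 / 2) ^ i) :=
          mul_le_mul h5 h4 (by positivity) (by positivity)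
      _ = 1 / 16 * (1 / 2) ^ i * (Y:ℝ) ^ (i + 1) := by ring
      _ ≤ _ := mul_le_mul_of_nonneg_left h3 (by positivity)
  refine (Finset.sum_le_sum hterm).trans ?_
  rw [← Finset.mul_sum]
  have := sum_range_pow_le (by norm_num : (0:ℝ) ≤ 1 / 2) (by norm_num) J
  norm_num at this ⊢
  linarith

theorem exists_log_div_four_le_sum_richSets :
    ∃ R K Y0 : ℕ, 2 ≤ R ∧ 6 ≤ K ∧ ∀ Y, Y0 ≤ Y →
      (∀ i, 4001 ≤ ∑ q ∈ primesIoc (Y ^ R ^ i) (Y ^ R ^ (i + 1)), 1 / (q:ℝ)) ∧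
      ∀ J W, Y ^ R ^ (J + K) ≤ W → Real.log W / 4 ≤
        ∑ U ∈ richSets (fun i => Y ^ R ^ i) (R ^ 2 + 1) J W, ∏ p ∈ U, 1 / (p:ℝ) := by
  obtain ⟨Y1, hY1⟩ := exists_div_eight_le_sum_primesIoc
  obtain ⟨Y2, hY2⟩ := exists_div_eight_le_sum_shiftedPrimes
  obtain ⟨ρ, hρ⟩ : ∃ ρ : ℕ, ρ = 8 * 4001 := ⟨_, rfl⟩
  obtain ⟨R, hR⟩ : ∃ R : ℕ, R = 2 ^ ρ := ⟨_, rfl⟩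
  have hR2 : 2 ≤ R := by
    rw [hR]
    exact Nat.le_self_pow (by omega) 2
  obtain ⟨s0, hs0⟩ := exists_sum_exp_min_le (R ^ 2 + 1)
  obtain ⟨Y3, hY3⟩ := exists_sum_sq_log_div_le R hR2 (20 * R * 2 ^ s0) (by positivity)
  obtain ⟨Y4, hY4⟩ := exists_forall_le_log 2
  refine ⟨R, 6 + s0, max (max (max Y1 Y2) (max Y3 Y4)) 2, hR2, by omega, fun Y hY => ?_⟩
  simp only [max_le_iff] at hY
  obtain ⟨⟨⟨hYa, hYb⟩, hYc, hYd⟩, hYe⟩ := hY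
  have hY0 : 0 < Y := by omega
  have hyY : ∀ i, Y ≤ Y ^ R ^ i := fun i => Nat.le_self_pow (by positivity) Y
  have hysucc : ∀ i, Y ^ R ^ (i + 1) = (Y ^ R ^ i) ^ R := fun i => by rw [← pow_mul, pow_succ]
  have hmono : ∀ i, Y ^ R ^ i ≤ Y ^ R ^ (i + 1) := fun i => by
    rw [hysucc]
    exact Nat.le_self_pow (by omega) _
  have hmert : ∀ i, 4001 ≤ ∑ q ∈ primesIoc (Y ^ R ^ i) (Y ^ R ^ (i + 1)), 1 / (q:ℝ) := by
    intro i
    have h1 := hY1 (Y ^ R ^ i) (hYa.trans (hyY i)) ρ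
    rw [← hR, ← hysucc] at h1
    refine le_trans ?_ h1
    rw [hρ]
    norm_num
  refine ⟨hmert, fun J W hW => ?_⟩
  have hYW : Y ≤ W := (hyY _).trans hW
  set s : ℕ → ℕ := fun i => min (s0 + i) (s0 + (J - i)) with hs
  refine log_div_four_le_sum_richSets (fun i => Y ^ R ^ i) (fun i => (Y ^ R ^ (i + 1)) ^ 20)
    (fun i => ((Y ^ R ^ (i + 1)) ^ 20) ^ 2 ^ s i) s (R ^ 2 + 1) J W (fun i => by positivity)
    hmono ?_ ?_ (hs0 J) ?_ (hY4 W (hYd.trans hYW))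
  · intro i hi
    refine le_trans ?_ hW
    rw [← pow_mul, ← pow_mul, ← mul_assoc]
    refine Nat.pow_le_pow_right hY0 ?_
    calc R ^ (i + 1) * 20 * 2 ^ s i ≤ R ^ (i + 1) * 2 ^ 5 * 2 ^ (s0 + (J - i)) :=
          Nat.mul_le_mul (Nat.mul_le_mul_left _ (by norm_num))
            (Nat.pow_le_pow_right two_pos (min_le_right _ _))
      _ = R ^ (i + 1) * 2 ^ (5 + s0 + (J - i)) := by rw [mul_assoc, ← pow_add, add_assoc]
      _ ≤ R ^ (i + 1) * R ^ (5 + s0 + (J - i)) :=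
          Nat.mul_le_mul_left _ (Nat.pow_le_pow_left hR2 _)
      _ = R ^ (J + (6 + s0)) := by
          rw [← pow_add]
          congr 1
          omega
  · intro i hi
    refine hY2 _ (hYb.trans ((hyY (i + 1)).trans (Nat.le_self_pow (by norm_num) _))) _ ?_ ?_ _
    · intro q hq
      obtain ⟨⟨h1, h2⟩, h3⟩ := mem_primesIoc.1 hq
      exact ⟨h3, (hYe.trans (hyY i)).trans_lt h1, Nat.pow_le_pow_left h2 20⟩
    · have := hmert i
      linarith
  · refine le_trans (Finset.sum_le_sum fun i _ => ?_) (hY3 Y hYc J)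
    refine div_le_div_of_nonneg_right ?_ (Nat.cast_nonneg _)
    refine pow_le_pow_left₀ ?_ ?_ 2
    · have : 0 ≤ Real.log ((((Y ^ R ^ (i + 1)) ^ 20) ^ 2 ^ s i : ℕ) : ℝ) :=
        Real.log_natCast_nonneg _
      linarith
    · have h1 : Real.log ((((Y ^ R ^ (i + 1)) ^ 20) ^ 2 ^ s i : ℕ) : ℝ) =
          ((R ^ (i + 1) * 20 * 2 ^ s i : ℕ) : ℝ) * Real.log Y := by
        rw [← pow_mul, ← pow_mul, Nat.cast_pow, Real.log_pow, mul_assoc]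
      have h2 : R ^ (i + 1) * 20 * 2 ^ s i ≤ 20 * R * 2 ^ s0 * (2 * R) ^ i := by
        calc R ^ (i + 1) * 20 * 2 ^ s i ≤ R ^ (i + 1) * 20 * 2 ^ (s0 + i) :=
              Nat.mul_le_mul_left _ (Nat.pow_le_pow_right two_pos (min_le_left _ _))
          _ = _ := by ring
      have h3 : ((R ^ (i + 1) * 20 * 2 ^ s i : ℕ) : ℝ) ≤ 20 * R * 2 ^ s0 * (2 * R) ^ i := by
        exact_mod_cast h2
      rw [h1]
      have := mul_le_mul_of_nonneg_right h3 (Real.log_natCast_nonneg Y)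
      linarith

lemma denseDivIn_mul_prime {h D q : ℕ} (hh : 0 < h) (hq : 0 < q) (hqD : q * (h * (h + 1)) ≤ D)
    (hD : DenseDivIn D (1 + 1 / h) (Set.Ico (h : ℝ) ((D : ℝ) / (h + 1)))) :
    DenseDivIn (D * q) (1 + 1 / h) (Set.Ico (h : ℝ) (((D * q : ℕ) : ℝ) / (h + 1))) := by
  intro y hy
  have hq' : (0:ℝ) < q := by exact_mod_cast hq
  have hqD' : (q:ℝ) * (h * (h + 1)) ≤ D := by exact_mod_cast hqD
  have hh' : (0:ℝ) < h + 1 := by positivity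
  by_cases hyD : y < (D:ℝ) / (h + 1)
  · obtain ⟨d, hd, h1, h2⟩ := hD y ⟨hy.1, hyD⟩
    exact ⟨d, hd.mul_right q, h1, h2⟩
  · have h3 : (q:ℝ) * h ≤ y := by
      refine le_trans ?_ (not_lt.1 hyD)
      rw [le_div_iff₀ hh']
      linarith
    obtain ⟨d, hd, h1, h2⟩ := hD (y / q) ⟨by rw [le_div_iff₀ hq']; linarith, by
      have := hy.2
      rw [lt_div_iff₀ hh'] at this
      rw [div_lt_iff₀ hq', div_mul_eq_mul_div, lt_div_iff₀ hh']
      push_cast at this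
      exact this⟩
    refine ⟨d * q, Nat.mul_dvd_mul_right hd q, ?_, ?_⟩
    · rw [div_lt_iff₀ hq'] at h1
      push_cast
      exact h1
    · rw [← mul_div_assoc, le_div_iff₀ hq'] at h2
      push_cast
      exact h2

lemma denseDivIn_two_pow_mul_factorial {h : ℕ} (hh : 0 < h) (a : ℕ) :
    DenseDivIn (2 ^ a * (2 * h).factorial) (1 + 1 / h) (Set.Ico (h : ℝ) (2 ^ a * (2 * h))) := by
  have hh' : (0:ℝ) < h := by exact_mod_cast hh
  induction a with
  | zero =>
    intro y hy
    have hy0 : 0 ≤ y := hh'.le.trans hy.1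
    refine ⟨⌊y⌋₊ + 1, ?_, ?_, ?_⟩
    · rw [pow_zero, one_mul]
      refine Nat.dvd_factorial (Nat.succ_pos _) ?_
      refine (Nat.floor_lt hy0).2 ?_
      have := hy.2
      push_cast
      linarith
    · push_cast
      exact Nat.lt_floor_add_one y
    · push_cast
      have h1 := Nat.floor_le hy0
      have h2 : 1 ≤ 1 / h * y := by
        rw [one_div_mul_eq_div, le_div_iff₀ hh']
        linarith [hy.1]
      linarith
  | succ a ih =>
    intro y hy
    have ha : (1:ℝ) ≤ 2 ^ a := one_le_pow₀ (by norm_num)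
    by_cases hya : y < 2 ^ a * (2 * h)
    · obtain ⟨d, hd, h1, h2⟩ := ih y ⟨hy.1, hya⟩
      exact ⟨d, hd.trans ⟨2, by ring⟩, h1, h2⟩
    · have h0 := hy.2
      rw [pow_succ] at h0
      obtain ⟨d, hd, h1, h2⟩ := ih (y / 2) ⟨by nlinarith, by linarith⟩
      refine ⟨2 * d, ?_, ?_, ?_⟩
      · rw [pow_succ', mul_assoc]
        exact Nat.mul_dvd_mul_left 2 hd
      · push_cast
        linarith
      · push_cast
        linarith

lemma exists_denseDivIn_base {h : ℕ} (hh : 0 < h) (B : ℕ) : ∃ Q : ℕ, B ≤ Q ∧ 0 < Q ∧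
    (∀ p, p.Prime → p ∣ Q → p ≤ 2 * h) ∧
    DenseDivIn Q (1 + 1 / h) (Set.Ico (h : ℝ) ((Q : ℝ) / (h + 1))) := by
  obtain ⟨F, hF⟩ : ∃ F, F = (2 * h).factorial := ⟨_, rfl⟩
  have hF0 : 0 < F := hF ▸ Nat.factorial_pos _
  obtain ⟨a, ha⟩ : ∃ a, a = F + B := ⟨_, rfl⟩
  have h2a : a < 2 ^ a := Nat.lt_two_pow_self
  have hbase := denseDivIn_two_pow_mul_factorial hh a
  rw [← hF] at hbase
  refine ⟨2 ^ a * F, ?_, by positivity, ?_, ?_⟩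
  · calc B ≤ 2 ^ a := by omega
      _ ≤ 2 ^ a * F := Nat.le_mul_of_pos_right _ hF0
  · intro p hp hpd
    rcases (Nat.Prime.dvd_mul hp).1 hpd with h1 | h1
    · have := (Nat.prime_dvd_prime_iff_eq hp Nat.prime_two).1 (hp.dvd_of_dvd_pow h1)
      omega
    · rw [hF] at h1
      exact (Nat.Prime.dvd_factorial hp).1 h1
  · intro y hy
    have hh' : (0:ℝ) < h := by exact_mod_cast hh
    have hF' : (0:ℝ) < F := by exact_mod_cast hF0
    have h2a' : (F:ℝ) < 2 ^ a := by
      have : F < 2 ^ a := by omega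
      exact_mod_cast this
    by_cases hya : y < 2 ^ a * (2 * h)
    · exact hbase y ⟨hy.1, hya⟩
    have hya := not_lt.1 hya
    have hy0 : 0 < y := hh'.trans_le hy.1
    obtain ⟨z, hz⟩ : ∃ z : ℝ, z = 2 ^ a * F * h / ((h + 1) * y) := ⟨_, rfl⟩
    have hyz : z * ((h + 1) * y) = 2 ^ a * F * h := by
      rw [hz]
      field_simp
    have hhz : (h:ℝ) < z := by
      have := hy.2
      rw [lt_div_iff₀ (by positivity)] at this
      push_cast at this
      rw [hz, lt_div_iff₀ (by positivity)]
      nlinarith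
    have hzF : z ≤ 2 ^ a := by
      rw [hz, div_le_iff₀ (by positivity)]
      have h1 : (2:ℝ) ^ a * F * h ≤ 2 ^ a * 2 ^ a * h := by
        refine mul_le_mul_of_nonneg_right (mul_le_mul_of_nonneg_left h2a'.le ?_) hh'.le
        positivity
      have h2 : (2:ℝ) ^ a * (2 ^ a * (2 * h)) ≤ 2 ^ a * y :=
        mul_le_mul_of_nonneg_left hya (by positivity)
      have h3 : 0 ≤ (2:ℝ) ^ a * y := by positivity
      have h4 : 0 ≤ (2:ℝ) ^ a * y * h := by positivity
      have h5 : 0 ≤ (2:ℝ) ^ a * 2 ^ a * h := by positivity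
      nlinarith
    have hz0 : 0 < z := hh'.trans hhz
    obtain ⟨m, hm⟩ : ∃ m, ⌈z⌉₊ = m + 1 :=
      Nat.exists_eq_succ_of_ne_zero (Nat.ceil_pos.2 hz0).ne'
    have hmz : (m:ℝ) < z := Nat.lt_ceil.1 (by omega)
    have hhm : h ≤ m := by
      have : h < ⌈z⌉₊ := Nat.lt_ceil.2 hhz
      omega
    obtain ⟨d, hd, h1, h2⟩ := hbase m ⟨by exact_mod_cast hhm, by
      have : (2:ℝ) ^ a * 1 ≤ 2 ^ a * (2 * h) := by
        refine mul_le_mul_of_nonneg_left ?_ (by positivity)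
        have : (1:ℝ) ≤ h := by exact_mod_cast hh
        linarith
      linarith⟩
    have hzd : z ≤ d := by
      have h3 : m < d := by exact_mod_cast h1
      exact Nat.ceil_le.1 (by omega)
    obtain ⟨e, he⟩ := hd
    have he' : (2:ℝ) ^ a * F = d * e := by exact_mod_cast he
    have hd0 : (0:ℝ) < d := hz0.trans_le hzd
    have h2' : (d:ℝ) * h < (h + 1) * z := by
      have h3 : (d:ℝ) * h ≤ (h + 1) * m := by
        have := mul_le_mul_of_nonneg_right h2 hh'.le
        rwa [show (1 + 1 / (h:ℝ)) * m * h = (h + 1) * m by field_simp] at this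
      nlinarith
    refine ⟨e, ⟨d, by rw [he]; ring⟩, ?_, ?_⟩
    · have h4 : (d * h) * y < (d * h) * e := by nlinarith
      exact lt_of_mul_lt_mul_left h4 (by positivity)
    · rw [show (1 + 1 / (h:ℝ)) * y = (h + 1) * y / h by field_simp, le_div_iff₀ hh']
      have h4 : (e * h) * d ≤ ((h + 1) * y) * d := by
        nlinarith [mul_le_mul_of_nonneg_right hzd (by positivity : 0 ≤ ((h:ℝ) + 1) * y)]
      exact le_of_mul_le_mul_right h4 hd0

lemma denseDivIn_mul_prod {h D : ℕ} (hh : 0 < h) (T : Finset ℕ)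
    (hD : DenseDivIn D (1 + 1 / h) (Set.Ico (h : ℝ) ((D : ℝ) / (h + 1))))
    (hT : ∀ q ∈ T, 0 < q ∧ q * (h * (h + 1)) ≤ D * ∏ p ∈ T.filter (· < q), p) :
    DenseDivIn (D * ∏ q ∈ T, q) (1 + 1 / h)
      (Set.Ico (h : ℝ) (((D * ∏ q ∈ T, q : ℕ) : ℝ) / (h + 1))) := by
  induction T using Finset.induction_on_max with
  | empty => simpa using hD
  | insert a T ha ih =>
    have haT : a ∉ T := fun h => (ha a h).false
    rw [Finset.prod_insert haT, mul_comm a, ← mul_assoc]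
    refine denseDivIn_mul_prime hh (hT a (Finset.mem_insert_self _ _)).1 ?_ (ih ?_)
    · have := (hT a (Finset.mem_insert_self _ _)).2
      rwa [Finset.filter_insert, if_neg (lt_irrefl a), Finset.filter_true_of_mem ha] at this
    · intro q hq
      have := hT q (Finset.mem_insert_of_mem hq)
      rwa [Finset.filter_insert, if_neg (ha q hq).not_gt] at this

lemma denseDivIn_mul_of_prime_le {h D : ℕ} (hh : 0 < h)
    (hD : DenseDivIn D (1 + 1 / h) (Set.Ico (h : ℝ) ((D : ℝ) / (h + 1)))) (c : ℕ) (hc : c ≠ 0)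
    (hp : ∀ p, p.Prime → p ∣ c → p * (h * (h + 1)) ≤ D) :
    DenseDivIn (D * c) (1 + 1 / h) (Set.Ico (h : ℝ) (((D * c : ℕ) : ℝ) / (h + 1))) := by
  induction c using induction_on_primes with
  | zero => exact absurd rfl hc
  | one => simpa using hD
  | prime_mul p a hpp ih =>
    have ha : a ≠ 0 := right_ne_zero_of_mul hc
    rw [mul_comm p, ← mul_assoc]
    refine denseDivIn_mul_prime hh hpp.pos ?_ (ih ha fun q hq hqa => hp q hq (hqa.mul_left p))
    exact (hp p hpp (dvd_mul_right p a)).trans (Nat.le_mul_of_pos_right _ (Nat.pos_of_ne_zero ha))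

lemma denseDivIn_of_dvd {h D M : ℕ} (hh : 0 < h) (hM : M ≠ 0) (hDM : D ∣ M)
    (hD : DenseDivIn D (1 + 1 / h) (Set.Ico (h : ℝ) ((D : ℝ) / (h + 1))))
    (hp : ∀ p, p.Prime → p ∣ M → p * (h * (h + 1)) ≤ D) :
    DenseDivIn M (1 + 1 / h) (Set.Ico (h : ℝ) ((M : ℝ) / (h + 1))) := by
  obtain ⟨c, rfl⟩ := hDM
  exact denseDivIn_mul_of_prime_le hh hD c (right_ne_zero_of_mul hM)
    fun p hpp hpc => hp p hpp (hpc.mul_left D)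

lemma carmichael_dvd_totient {n : ℕ} (hn : n ≠ 0) : carmichael n ∣ n.totient := by
  have : NeZero n := ⟨hn⟩
  rw [← ZMod.card_units_eq_totient, ← Nat.card_eq_fintype_card]
  exact Group.exponent_dvd_nat_card

lemma carmichael_ne_zero {n : ℕ} (hn : n ≠ 0) : carmichael n ≠ 0 := fun h =>
  (Nat.totient_pos.2 (Nat.pos_of_ne_zero hn)).ne'
    (Nat.eq_zero_of_zero_dvd (h ▸ carmichael_dvd_totient hn))

lemma sub_one_dvd_carmichael {p n : ℕ} (hp : p.Prime) (hpn : p ∣ n) (hn : n ≠ 0) :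
    p - 1 ∣ carmichael n := by
  have : NeZero n := ⟨hn⟩
  have : Fact p.Prime := ⟨hp⟩
  have h1 : Monoid.exponent (ZMod p)ˣ = p - 1 := by
    rw [IsCyclic.exponent_eq_card, Nat.card_eq_fintype_card, ZMod.card_units]
  rw [← h1]
  exact MonoidHom.exponent_dvd (f := ZMod.unitsMap hpn) (ZMod.unitsMap_surjective hpn)

lemma prime_le_of_dvd_totient {n B q : ℕ} (hB : ∀ p, p.Prime → p ∣ n → p ≤ B)
    (hq : q.Prime) (hqn : q ∣ n.totient) : q ≤ B := by
  have h1 : q ∣ n * ∏ p ∈ n.primeFactors, (p - 1) := by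
    rw [← Nat.totient_mul_prod_primeFactors]
    exact hqn.mul_right _
  rcases hq.dvd_mul.1 h1 with h2 | h2
  · exact hB q hq h2
  · obtain ⟨p, hp, h3⟩ := (hq.prime.dvd_finsetProd_iff _).1 h2
    have hpp := Nat.prime_of_mem_primeFactors hp
    have := Nat.le_of_dvd (Nat.sub_pos_of_lt hpp.one_lt) h3
    exact (this.trans (Nat.sub_le p 1)).trans (hB p hpp (Nat.dvd_of_mem_primeFactors hp))

lemma exists_lt_le_of_strictMono {y : ℕ → ℕ} {q : ℕ} (J : ℕ) (h0 : y 0 < q) (hJ : q ≤ y J) :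
    ∃ i < J, y i < q ∧ q ≤ y (i + 1) := by
  induction J with
  | zero => omega
  | succ J ih =>
    by_cases hq : q ≤ y J
    · obtain ⟨i, hi, h1⟩ := ih hq
      exact ⟨i, by omega, h1⟩
    · exact ⟨J, by omega, by omega, hJ⟩

lemma pow_le_prod_of_le_card {S : Finset ℕ} {a N : ℕ} (ha : 0 < a) (hS : ∀ q ∈ S, a ≤ q)
    (hN : N ≤ S.card) : a ^ N ≤ ∏ q ∈ S, q := by
  calc a ^ N ≤ a ^ S.card := Nat.pow_le_pow_right ha hN
    _ ≤ ∏ q ∈ S, q := Finset.pow_card_le_prod S _ a hS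

theorem denseDivIn_of_divisors {h Q Y R k n J B : ℕ} (hh : 0 < h) (hR : 2 ≤ R)
    (hQY : h * (h + 1) * Y ^ R ≤ Q) (hQp : ∀ p, p.Prime → p ∣ Q → p ≤ Y)
    (hQ : DenseDivIn Q (1 + 1 / h) (Set.Ico (h : ℝ) ((Q : ℝ) / (h + 1))))
    (hY : 2 ≤ Y) (hn : n ≠ 0) (hQn : Q ∣ carmichael n)
    (hI : ∀ i < J, R ^ 2 + 1 ≤ ((primesIoc (Y ^ R ^ i) (Y ^ R ^ (i + 1))).filter
      (· ∣ carmichael n)).card)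
    (hJ : k ≤ ((primesIoc (Y ^ R ^ J) (Y ^ R ^ (J + 1))).filter (· ∣ carmichael n)).card)
    (hB : ∀ p, p.Prime → p ∣ n → p ≤ B) (hBJ : B ≤ (Y ^ R ^ J) ^ k) :
    DenseDivIn n.totient (1 + 1 / h) (Set.Ico (h : ℝ) ((n.totient : ℝ) / (h + 1))) ∧
    DenseDivIn (carmichael n) (1 + 1 / h)
      (Set.Ico (h : ℝ) ((carmichael n : ℝ) / (h + 1))) := by
  have hY0 : 0 < Y := by omega
  have hyY : ∀ i, Y ≤ Y ^ R ^ i := fun i => Nat.le_self_pow (by positivity) Y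
  have hy0 : ∀ i, 0 < Y ^ R ^ i := fun i => by positivity
  have hymono : ∀ i j, i ≤ j → Y ^ R ^ i ≤ Y ^ R ^ j := fun i j hij =>
    Nat.pow_le_pow_right hY0 (Nat.pow_le_pow_right (by omega) hij)
  have hQh : h * (h + 1) ≤ Q :=
    (Nat.le_mul_of_pos_right _ (by positivity)).trans hQY
  obtain ⟨T, hT⟩ : ∃ T, T = (primesIoc Y (Y ^ R ^ (J + 1))).filter (· ∣ carmichael n) := ⟨_, rfl⟩
  have hsub : ∀ i ≤ J, (primesIoc (Y ^ R ^ i) (Y ^ R ^ (i + 1))).filter (· ∣ carmichael n) ⊆ T := by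
    intro i hi q hq
    rw [Finset.mem_filter, mem_primesIoc] at hq
    rw [hT, Finset.mem_filter, mem_primesIoc]
    exact ⟨⟨⟨(hyY i).trans_lt hq.1.1.1, hq.1.1.2.trans (hymono _ _ (by omega))⟩, hq.1.2⟩, hq.2⟩
  have hTp : ∀ q ∈ T, q.Prime ∧ Y < q ∧ q ≤ Y ^ R ^ (J + 1) ∧ q ∣ carmichael n := by
    intro q hq
    rw [hT, Finset.mem_filter, mem_primesIoc] at hq
    exact ⟨hq.1.2, hq.1.1.1, hq.1.1.2, hq.2⟩
  have hTdvd : ∏ q ∈ T, q ∣ carmichael n :=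
    Finset.prod_primes_dvd _ (fun q hq => (hTp q hq).1.prime) fun q hq => (hTp q hq).2.2.2
  have hcop : Nat.Coprime Q (∏ q ∈ T, q) := by
    refine Nat.Coprime.prod_right fun q hq => ?_
    refine ((hTp q hq).1.coprime_iff_not_dvd.2 fun hqQ => ?_).symm
    have := hQp q (hTp q hq).1 hqQ
    have := (hTp q hq).2.1
    omega
  have hD : DenseDivIn (Q * ∏ q ∈ T, q) (1 + 1 / h)
      (Set.Ico (h : ℝ) (((Q * ∏ q ∈ T, q : ℕ) : ℝ) / (h + 1))) := by
    refine denseDivIn_mul_prod hh T hQ fun q hq => ⟨(hTp q hq).1.pos, ?_⟩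
    obtain ⟨i, hi, h1, h2⟩ := exists_lt_le_of_strictMono (y := fun i => Y ^ R ^ i) (J + 1)
      (by simpa using (hTp q hq).2.1) (hTp q hq).2.2.1
    have hpos : 0 < ∏ p ∈ T.filter (· < q), p :=
      Finset.prod_pos fun p hp => (hTp p (Finset.mem_filter.1 hp).1).1.pos
    rcases i with _ | i
    · rw [zero_add, pow_one] at h2
      calc q * (h * (h + 1)) ≤ Y ^ R * (h * (h + 1)) := Nat.mul_le_mul_right _ h2
        _ = h * (h + 1) * Y ^ R := mul_comm _ _
        _ ≤ Q := hQY
        _ ≤ _ := Nat.le_mul_of_pos_right _ hpos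
    · rw [mul_comm]
      refine Nat.mul_le_mul hQh ?_
      calc q ≤ Y ^ R ^ (i + 1 + 1) := h2
        _ = (Y ^ R ^ i) ^ R ^ 2 := by rw [← pow_mul, ← pow_add]
        _ ≤ (Y ^ R ^ i) ^ (R ^ 2 + 1) := Nat.pow_le_pow_right (hy0 i) (Nat.le_succ _)
        _ ≤ ∏ p ∈ (primesIoc (Y ^ R ^ i) (Y ^ R ^ (i + 1))).filter (· ∣ carmichael n), p :=
          pow_le_prod_of_le_card (hy0 i)
            (fun p hp => (mem_primesIoc.1 (Finset.mem_filter.1 hp).1).1.1.le) (hI i (by omega))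
        _ ≤ ∏ p ∈ T.filter (· < q), p := by
          refine Finset.prod_le_prod_of_subset_of_one_le' ?_ ?_
          · intro p hp
            refine Finset.mem_filter.2 ⟨hsub i (by omega) hp, ?_⟩
            exact (mem_primesIoc.1 (Finset.mem_filter.1 hp).1).1.2.trans_lt h1
          · intro p hp _
            exact (hTp p (Finset.mem_filter.1 hp).1).1.pos
  have hDB : B * (h * (h + 1)) ≤ Q * ∏ q ∈ T, q := by
    rw [mul_comm]
    refine Nat.mul_le_mul hQh (hBJ.trans ?_)
    calc (Y ^ R ^ J) ^ k
        ≤ ∏ p ∈ (primesIoc (Y ^ R ^ J) (Y ^ R ^ (J + 1))).filter (· ∣ carmichael n), p :=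
          pow_le_prod_of_le_card (hy0 J)
            (fun p hp => (mem_primesIoc.1 (Finset.mem_filter.1 hp).1).1.1.le) hJ
      _ ≤ ∏ q ∈ T, q := Finset.prod_le_prod_of_subset_of_one_le' (hsub J le_rfl)
          fun p hp _ => (hTp p hp).1.pos
  have hDn : Q * ∏ q ∈ T, q ∣ carmichael n := hcop.mul_dvd_of_dvd_of_dvd hQn hTdvd
  have hprime : ∀ p, p.Prime → p ∣ n.totient → p * (h * (h + 1)) ≤ Q * ∏ q ∈ T, q :=
    fun p hp hpn => (Nat.mul_le_mul_right _ (prime_le_of_dvd_totient hB hp hpn)).trans hDB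
  exact ⟨denseDivIn_of_dvd hh (Nat.totient_pos.2 (Nat.pos_of_ne_zero hn)).ne'
      (hDn.trans (carmichael_dvd_totient hn)) hD hprime,
    denseDivIn_of_dvd hh (carmichael_ne_zero hn) hDn hD
      fun p hp hpn => hprime p hp (hpn.trans (carmichael_dvd_totient hn))⟩

lemma exists_inv_le_sum_shiftedPrimes_pow : ∃ w0 : ℕ, 2 ≤ w0 ∧ ∀ w, w0 ≤ w → ∀ m : ℕ, 0 < m →
    ∀ 𝒬 : Finset ℕ, (∀ q ∈ 𝒬, q.Prime ∧ 2 < q ∧ q ^ 20 ≤ w ^ m) →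
      4000 ≤ ∑ q ∈ 𝒬, 1 / (q:ℝ) →
      1 / (4 * (m + 1) : ℝ) ≤ ∑ p ∈ shiftedPrimes 𝒬 (w ^ m) (w ^ (m + 1)), 1 / (p:ℝ) := by
  obtain ⟨C, hC, H⟩ := exists_log_sub_le_sum_shiftedPrimes
  obtain ⟨B, hB⟩ : ∃ B : ℕ, B = 10 ^ 140 := ⟨_, rfl⟩
  rw [← hB] at H
  clear hB
  obtain ⟨w1, hw1⟩ := exists_forall_le_log (max (4 * C) 1)
  refine ⟨max (max w1 B) 2, le_max_right _ _, fun w hw m hm 𝒬 hq hs => ?_⟩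
  simp only [max_le_iff] at hw
  have hlog := hw1 w hw.1.1
  rw [max_le_iff] at hlog
  have hL : 0 < Real.log w := by linarith
  have hww : w ≤ w ^ m := Nat.le_self_pow hm.ne' w
  have h1 := H (w ^ m) (w ^ (m + 1)) 𝒬 (hw.1.2.trans hww)
    (Nat.pow_le_pow_right (by omega) (Nat.le_succ m)) hq hs
  rw [Nat.cast_pow, Nat.cast_pow, Real.log_pow, Real.log_pow] at h1
  push_cast at h1
  set S := ∑ p ∈ shiftedPrimes 𝒬 (w ^ m) (w ^ (m + 1)), 1 / (p:ℝ)
  rw [div_le_iff₀ (by positivity)]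
  have h2 : 1 / 4 * Real.log w ≤ ((m + 1) * S) * Real.log w := by nlinarith
  have := le_of_mul_le_mul_right h2 hL
  linarith

lemma hitBy_subset (I V : Finset ℕ) : hitBy I V ⊆ I := Finset.filter_subset _ _

lemma hitBy_mono {I U V : Finset ℕ} (h : U ⊆ V) : hitBy I U ⊆ hitBy I V := fun q hq => by
  rw [hitBy, Finset.mem_filter] at hq ⊢
  obtain ⟨h1, p, hp, h2⟩ := hq
  exact ⟨h1, p, h hp, h2⟩

lemma card_lt_card_hitBy_insert {I V : Finset ℕ} {p u v : ℕ}
    (hp : p ∈ shiftedPrimes (I \ hitBy I V) u v) :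
    (hitBy I V).card < (hitBy I (insert p V)).card := by
  rw [shiftedPrimes, Finset.mem_filter] at hp
  obtain ⟨-, q, hq, hqp⟩ := hp
  rw [Finset.mem_sdiff] at hq
  refine Finset.card_lt_card (Finset.ssubset_iff_subset_ne.2
    ⟨hitBy_mono (Finset.subset_insert p V), fun h => hq.2 ?_⟩)
  rw [h, hitBy, Finset.mem_filter]
  exact ⟨hq.1, p, Finset.mem_insert_self p V, hqp⟩

lemma sum_insert_image_eq {𝒱 : Finset (Finset ℕ)} {M : ℕ} (P : Finset ℕ → Finset ℕ)
    (h1 : ∀ V ∈ 𝒱, ∀ p ∈ V, p ≤ M) (h2 : ∀ V ∈ 𝒱, ∀ p ∈ P V, M < p) (f : ℕ → ℝ) :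
    ∑ V ∈ (𝒱.sigma P).image (fun x => insert x.2 x.1), ∏ p ∈ V, f p =
      ∑ V ∈ 𝒱, (∑ p ∈ P V, f p) * ∏ p ∈ V, f p := by
  have hfilter : ∀ x ∈ 𝒱.sigma P, (insert x.2 x.1).filter (· ≤ M) = x.1 := by
    rintro ⟨V, p⟩ hx
    rw [Finset.mem_sigma] at hx
    rw [Finset.filter_insert, if_neg (h2 V hx.1 p hx.2).not_ge,
      Finset.filter_true_of_mem (h1 V hx.1)]
  rw [Finset.sum_image, Finset.sum_sigma]
  · refine Finset.sum_congr rfl fun V hV => ?_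
    rw [Finset.sum_mul]
    refine Finset.sum_congr rfl fun p hp => ?_
    exact Finset.prod_insert fun hpV => ((h1 V hV p hpV).trans_lt (h2 V hV p hp)).false
  · rintro ⟨V, p⟩ hx ⟨V', p'⟩ hx' heq
    simp only at heq
    have hV : V = V' := by
      have := hfilter _ hx
      simp only at this
      rw [← this, heq]
      exact hfilter _ hx'
    subst hV
    have hx := Finset.mem_sigma.1 hx
    have hp : p ∈ insert p' V := heq ▸ Finset.mem_insert_self p V
    rcases Finset.mem_insert.1 hp with h | h
    · rw [h]
    · exact absurd (h1 V hx.1 p h) (h2 V hx.1 p hx.2).not_ge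

lemma sub_card_div_le_sum_sdiff {I S : Finset ℕ} {k : ℕ} (hk : 0 < k) (hI : ∀ q ∈ I, k ≤ q)
    (hSI : S ⊆ I) (hS : S.card ≤ k) :
    ∑ q ∈ I, 1 / (q:ℝ) - 1 ≤ ∑ q ∈ I \ S, 1 / (q:ℝ) := by
  rw [← Finset.sum_sdiff hSI]
  have hk' : (0:ℝ) < k := by exact_mod_cast hk
  have h1 : ∑ q ∈ S, 1 / (q:ℝ) ≤ S.card • (1 / (k:ℝ)) :=
    Finset.sum_le_card_nsmul S _ _ fun q hq =>
      one_div_le_one_div_of_le hk' (by exact_mod_cast hI q (hSI hq))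
  rw [nsmul_eq_mul, mul_one_div] at h1
  have h2 : (S.card : ℝ) / k ≤ 1 := (div_le_one hk').2 (by exact_mod_cast hS)
  linarith

theorem exists_le_sum_layered (k : ℕ) (hk : 0 < k) : ∃ c : ℝ, 0 < c ∧ ∃ w0 : ℕ, 2 ≤ w0 ∧
    ∀ w, w0 ≤ w → ∀ I : Finset ℕ,
      (∀ q ∈ I, q.Prime ∧ 2 < q ∧ k ≤ q ∧ q ^ 20 ≤ w ^ k ^ 2) → 4001 ≤ ∑ q ∈ I, 1 / (q:ℝ) →
      ∃ 𝒱 : Finset (Finset ℕ), (∀ V ∈ 𝒱, V.card = k ∧ k ≤ (hitBy I V).card ∧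
        ∀ p ∈ V, p.Prime ∧ w ^ k ^ 2 < p ∧ p ≤ w ^ (k ^ 2 + k)) ∧
        c ≤ ∑ V ∈ 𝒱, ∏ p ∈ V, 1 / (p:ℝ) := by
  obtain ⟨w0, hw02, H⟩ := exists_inv_le_sum_shiftedPrimes_pow
  obtain ⟨b, hb⟩ : ∃ b : ℝ, b = 1 / (4 * ((k ^ 2 + k : ℕ) + 1)) := ⟨_, rfl⟩
  have hb0 : 0 < b := by
    rw [hb]
    positivity
  refine ⟨b ^ k, pow_pos hb0 k, w0, hw02, fun w hw I hI hs => ?_⟩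
  have hw0 : 0 < w := by omega
  suffices h : ∀ l ≤ k, ∃ 𝒱 : Finset (Finset ℕ), (∀ V ∈ 𝒱, V.card = l ∧ l ≤ (hitBy I V).card ∧
      ∀ p ∈ V, p.Prime ∧ w ^ k ^ 2 < p ∧ p ≤ w ^ (k ^ 2 + l)) ∧
      b ^ l ≤ ∑ V ∈ 𝒱, ∏ p ∈ V, 1 / (p:ℝ) from h k le_rfl
  intro l
  induction l with
  | zero => exact fun _ => ⟨{∅}, by simp, by simp⟩
  | succ l ih =>
    intro hl
    obtain ⟨𝒱, h𝒱, hsum⟩ := ih (by omega)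
    have hlow : w ^ k ^ 2 ≤ w ^ (k ^ 2 + l) := Nat.pow_le_pow_right hw0 (by omega)
    have hup : w ^ (k ^ 2 + l) ≤ w ^ (k ^ 2 + (l + 1)) := Nat.pow_le_pow_right hw0 (by omega)
    have hstep : ∀ V : Finset ℕ, V ∈ 𝒱 → ∃ P : Finset ℕ,
        (∀ p ∈ P, p.Prime ∧ w ^ (k ^ 2 + l) < p ∧ p ≤ w ^ (k ^ 2 + (l + 1)) ∧
          l + 1 ≤ (hitBy I (insert p V)).card) ∧ b ≤ ∑ p ∈ P, 1 / (p:ℝ) := by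
      intro V hV
      have hkey : ∀ 𝒬 ⊆ I, 4000 ≤ ∑ q ∈ 𝒬, 1 / (q:ℝ) →
          b ≤ ∑ p ∈ shiftedPrimes 𝒬 (w ^ (k ^ 2 + l)) (w ^ (k ^ 2 + l + 1)), 1 / (p:ℝ) := by
        intro 𝒬 h𝒬 h4
        refine le_trans ?_ (H w hw (k ^ 2 + l) (by positivity) 𝒬 (fun q hq => ?_) h4)
        · rw [hb]
          refine one_div_le_one_div_of_le (by positivity) ?_
          have : ((k ^ 2 + l : ℕ) : ℝ) ≤ (k ^ 2 + k : ℕ) := by exact_mod_cast (by omega)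
          linarith
        · have := hI q (h𝒬 hq)
          exact ⟨this.1, this.2.1, this.2.2.2.trans hlow⟩
      have hmem : ∀ 𝒬 : Finset ℕ, ∀ p ∈ shiftedPrimes 𝒬 (w ^ (k ^ 2 + l)) (w ^ (k ^ 2 + l + 1)),
          p.Prime ∧ w ^ (k ^ 2 + l) < p ∧ p ≤ w ^ (k ^ 2 + (l + 1)) := by
        intro 𝒬 p hp
        rw [shiftedPrimes, Finset.mem_filter, mem_primesIoc] at hp
        exact ⟨hp.1.2, hp.1.1.1, hp.1.1.2⟩
      by_cases hlt : l < (hitBy I V).card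
      · refine ⟨_, fun p hp => ⟨(hmem I p hp).1, (hmem I p hp).2.1, (hmem I p hp).2.2, ?_⟩,
          hkey I subset_rfl (by linarith)⟩
        exact hlt.trans_le (Finset.card_le_card (hitBy_mono (Finset.subset_insert p V)))
      · refine ⟨_, fun p hp => ⟨(hmem _ p hp).1, (hmem _ p hp).2.1, (hmem _ p hp).2.2, ?_⟩,
          hkey (I \ hitBy I V) Finset.sdiff_subset ?_⟩
        · have := card_lt_card_hitBy_insert hp
          have := (h𝒱 V hV).2.1
          omega
        · have := sub_card_div_le_sum_sdiff hk (fun q hq => (hI q hq).2.2.1)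
            (hitBy_subset I V) (by omega)
          linarith
    choose! P hP hPs using hstep
    refine ⟨(𝒱.sigma P).image (fun x => insert x.2 x.1), fun U hU => ?_, ?_⟩
    · obtain ⟨⟨V, p⟩, hx, rfl⟩ := Finset.mem_image.1 hU
      obtain ⟨hV, hp⟩ := Finset.mem_sigma.1 hx
      simp only at hV hp ⊢
      have hpP := hP V hV p hp
      have hVV := h𝒱 V hV
      refine ⟨?_, hpP.2.2.2, fun r hr => ?_⟩
      · rw [Finset.card_insert_of_notMem, hVV.1]
        exact fun h => ((hVV.2.2 p h).2.2.trans_lt hpP.2.1).false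
      · rcases Finset.mem_insert.1 hr with rfl | hr
        · exact ⟨hpP.1, hlow.trans_lt hpP.2.1, hpP.2.2.1⟩
        · exact ⟨(hVV.2.2 r hr).1, (hVV.2.2 r hr).2.1, (hVV.2.2 r hr).2.2.trans hup⟩
    · rw [sum_insert_image_eq (M := w ^ (k ^ 2 + l)) P (fun V hV p hp => ((h𝒱 V hV).2.2 p hp).2.2)
        (fun V hV p hp => (hP V hV p hp).2.1), pow_succ']
      calc b * b ^ l ≤ b * ∑ V ∈ 𝒱, ∏ p ∈ V, 1 / (p:ℝ) := mul_le_mul_of_nonneg_left hsum hb0.le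
        _ = ∑ V ∈ 𝒱, b * ∏ p ∈ V, 1 / (p:ℝ) := Finset.mul_sum _ _ _
        _ ≤ _ := Finset.sum_le_sum fun V hV => mul_le_mul_of_nonneg_right (hPs V hV)
          (Finset.prod_nonneg fun p _ => by positivity)

lemma exists_le_card_primesIoc : ∃ T0 : ℕ, 2 ≤ T0 ∧ ∀ T M : ℕ, T0 ≤ T → M ^ 2 ≤ T →
    (T:ℝ) / (4 * Real.log T) ≤ (primesIoc M T).card := by
  have h1 : Tendsto (fun T : ℕ => Real.log T ^ 2 / (T:ℝ)) atTop (nhds 0) :=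
    (Real.isLittleO_pow_log_id_atTop (n := 2)).tendsto_div_nhds_zero.comp
      tendsto_natCast_atTop_atTop
  obtain ⟨T1, hT1⟩ := eventually_atTop.1
    (h1.eventually_le_const (by norm_num : (0:ℝ) < 1 / 100))
  obtain ⟨T2, hT2⟩ := exists_forall_le_log 1
  refine ⟨max (max T1 T2) 10000, (by norm_num : 2 ≤ 10000).trans (le_max_right _ _),
    fun T M hT hM => ?_⟩
  simp only [max_le_iff] at hT
  have hL := hT2 T hT.1.2
  have hT3 := hT1 T hT.1.1
  have hT4 : (10000:ℝ) ≤ T := by exact_mod_cast hT.2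
  have hT0 : (0:ℝ) < T := by linarith
  have hM' : (M:ℝ) ^ 2 ≤ T := by exact_mod_cast hM
  have hpi := Chebyshev.pi_ge T
  have hcard : (Nat.primeCounting T : ℝ) ≤ (primesIoc M T).card + M := by
    have : Nat.primeCounting T ≤ (primesIoc M T).card + M := by
      rw [Nat.primeCounting, Nat.primeCounting', Nat.count_eq_card_filter_range]
      calc _ ≤ (primesIoc M T ∪ Finset.Icc 1 M).card := by
            refine Finset.card_le_card fun p hp => ?_
            rw [Finset.mem_filter, Finset.mem_range] at hp
            rw [Finset.mem_union, mem_primesIoc, Finset.mem_Icc]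
            have := hp.2.one_lt
            by_cases h : M < p
            · exact Or.inl ⟨⟨h, by omega⟩, hp.2⟩
            · exact Or.inr ⟨by omega, by omega⟩
        _ ≤ _ := (Finset.card_union_le _ _).trans (by simp)
    exact_mod_cast this
  have hlog2 := Real.log_two_gt_d9
  have hL0 : 0 < Real.log T := by linarith
  have hlogT : Real.log (T + 1) ≤ T / 10 := by
    have h2 : Real.log (T + 1) ≤ Real.log T + 1 := by
      have : Real.log (T + 1) ≤ Real.log (T * Real.exp 1) := by
        refine Real.log_le_log (by linarith) ?_
        have := Real.add_one_le_exp 1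
        nlinarith
      rwa [Real.log_mul hT0.ne' (Real.exp_pos 1).ne', Real.log_exp] at this
    rw [div_le_iff₀ hT0] at hT3
    nlinarith
  have hML : M * Real.log T ≤ T / 10 := by
    rw [div_le_iff₀ hT0] at hT3
    refine abs_le_of_sq_le_sq' ?_ (by positivity) |>.2
    calc (M * Real.log T) ^ 2 = (M:ℝ) ^ 2 * Real.log T ^ 2 := mul_pow _ _ _
      _ ≤ T * (1 / 100 * T) := mul_le_mul hM' hT3 (by positivity) hT0.le
      _ = (T / 10) ^ 2 := by ring
  rw [div_le_iff₀ hL0] at hpi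
  rw [div_le_iff₀ (by positivity)]
  have := mul_le_mul_of_nonneg_right hcard hL0.le
  nlinarith

lemma le_card_filter_of_le_card_primesIoc {𝒰 𝒱 : Finset (Finset ℕ)} {m X W M : ℕ} {δ : ℝ}
    (good : ℕ → Prop) [DecidablePred good] (hm : 0 < m)
    (hU : ∀ U ∈ 𝒰, ∀ p ∈ U, p.Prime ∧ p ≤ W) (hV : ∀ V ∈ 𝒱, ∀ p ∈ V, p.Prime ∧ W < p ∧ p ≤ M)
    (hWM : W ≤ M)
    (hgood : ∀ U ∈ 𝒰, ∀ V ∈ 𝒱, ∀ p ∈ primesIoc M (X / (m * ((∏ q ∈ U, q) * ∏ q ∈ V, q))),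
      good (m * ((∏ q ∈ U, q) * ∏ q ∈ V, q) * p))
    (hcard : ∀ U ∈ 𝒰, ∀ V ∈ 𝒱, δ * ((∏ q ∈ U, 1 / (q:ℝ)) * ∏ q ∈ V, 1 / (q:ℝ)) ≤
      (primesIoc M (X / (m * ((∏ q ∈ U, q) * ∏ q ∈ V, q)))).card) :
    δ * ((∑ U ∈ 𝒰, ∏ q ∈ U, 1 / (q:ℝ)) * ∑ V ∈ 𝒱, ∏ q ∈ V, 1 / (q:ℝ)) ≤
      ((Finset.Icc 1 X).filter good).card := by
  have hpos : ∀ U ∈ 𝒰, ∀ V ∈ 𝒱, 0 < m * ((∏ q ∈ U, q) * ∏ q ∈ V, q) := fun U hUU V hVV =>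
    Nat.mul_pos hm (Nat.mul_pos (Finset.prod_pos fun p hp => (hU U hUU p hp).1.pos)
      (Finset.prod_pos fun p hp => (hV V hVV p hp).1.pos))
  obtain ⟨Z, hZ⟩ : ∃ Z : Finset (Σ _ : Finset ℕ × Finset ℕ, ℕ), Z = (𝒰 ×ˢ 𝒱).sigma fun x =>
    primesIoc M (X / (m * ((∏ q ∈ x.1, q) * ∏ q ∈ x.2, q))) := ⟨_, rfl⟩
  have hle : Z.card ≤ ((Finset.Icc 1 X).filter good).card := by
    refine Finset.card_le_card_of_injOn
      (fun x => m * ((∏ q ∈ x.1.1, q) * ∏ q ∈ x.1.2, q) * x.2) ?_ ?_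
    · rintro ⟨⟨U, V⟩, p⟩ hx
      rw [hZ, Finset.mem_coe, Finset.mem_sigma, Finset.mem_product] at hx
      obtain ⟨⟨hUU, hVV⟩, hp⟩ := hx
      rw [Finset.mem_coe, Finset.mem_filter, Finset.mem_Icc]
      have hpp := mem_primesIoc.1 hp
      refine ⟨⟨Nat.mul_pos (hpos U hUU V hVV) hpp.2.pos, ?_⟩, hgood U hUU V hVV p hp⟩
      have := (Nat.le_div_iff_mul_le (hpos U hUU V hVV)).1 hpp.1.2
      rwa [mul_comm] at this
    · have key : ∀ U ∈ 𝒰, ∀ V ∈ 𝒱, ∀ p, M < p → p.Prime → ∀ S : Finset ℕ,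
          S = ((∏ q ∈ U, q) * (∏ q ∈ V, q) * p).primeFactors →
          U = S.filter (· ≤ W) ∧ V = S.filter (fun q => W < q ∧ q ≤ M) ∧
          S.filter (M < ·) = {p} := by
        intro U hUU V hVV p hMp hp S hS
        have hUVd : Disjoint U V := Finset.disjoint_left.2 fun q hq hq' =>
          ((hU U hUU q hq).2.trans_lt (hV V hVV q hq').2.1).false
        have hpUV : p ∉ U ∪ V := fun h => by
          rcases Finset.mem_union.1 h with h | h
          · exact ((hU U hUU p h).2.trans hWM).not_gt hMp
          · exact (hV V hVV p h).2.2.not_gt hMp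
        have hS' : S = insert p (U ∪ V) := by
          rw [hS, ← Finset.prod_union hUVd, mul_comm,
            ← Finset.prod_insert (f := fun q : ℕ => q) hpUV]
          refine Nat.primeFactors_prod fun q hq => ?_
          rcases Finset.mem_insert.1 hq with rfl | h
          · exact hp
          · rcases Finset.mem_union.1 h with h | h
            · exact (hU U hUU q h).1
            · exact (hV V hVV q h).1
        have hUm := fun q h => (hU U hUU q h).2
        have hVm := fun q h => (hV V hVV q h).2
        subst hS'
        refine ⟨?_, ?_, ?_⟩
        · ext q
          have := hUm q
          have := hVm q
          simp only [Finset.mem_filter, Finset.mem_insert, Finset.mem_union]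
          grind
        · ext q
          have := hUm q
          have := hVm q
          simp only [Finset.mem_filter, Finset.mem_insert, Finset.mem_union]
          grind
        · ext q
          have := hUm q
          have := hVm q
          simp only [Finset.mem_filter, Finset.mem_insert, Finset.mem_union, Finset.mem_singleton]
          grind
      rintro ⟨⟨U, V⟩, p⟩ hx ⟨⟨U', V'⟩, p'⟩ hx' heq
      rw [hZ, Finset.mem_coe, Finset.mem_sigma, Finset.mem_product] at hx hx'
      obtain ⟨⟨hUU, hVV⟩, hp⟩ := hx
      obtain ⟨⟨hUU', hVV'⟩, hp'⟩ := hx'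
      have hpp := mem_primesIoc.1 hp
      have hpp' := mem_primesIoc.1 hp'
      simp only at heq hUU hVV hUU' hVV'
      rw [mul_assoc, mul_assoc m] at heq
      have heq := Nat.eq_of_mul_eq_mul_left hm heq
      obtain ⟨k1, k2, k3⟩ := key U hUU V hVV p hpp.1.1 hpp.2 _ rfl
      obtain ⟨l1, l2, l3⟩ := key U' hUU' V' hVV' p' hpp'.1.1 hpp'.2 _ (congrArg Nat.primeFactors heq)
      have e1 : U = U' := k1.trans l1.symm
      have e2 : V = V' := k2.trans l2.symm
      have e3 : p = p' := Finset.singleton_injective (k3.symm.trans l3)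
      rw [e1, e2, e3]
  refine le_trans ?_ (Nat.cast_le.2 hle)
  rw [hZ, Finset.card_sigma, Finset.sum_mul_sum, Nat.cast_sum, Finset.sum_product, Finset.mul_sum]
  refine Finset.sum_le_sum fun U hUU => ?_
  rw [Finset.mul_sum]
  exact Finset.sum_le_sum fun V hVV => hcard U hUU V hVV

lemma div_bounds_of_pow_bounds {w k W E X m a b : ℕ} (hk : 0 < k) (hW : W = w ^ k ^ 2)
    (hE : E = k ^ 2 * (k + 22)) (hw : 2 ^ E ≤ w) (hX : w ^ E ≤ X) (hX' : X < (w + 1) ^ E)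
    (hm : 0 < m) (hmW : m ≤ W) (ha : 0 < a) (haW : a ≤ W ^ 16) (hb : W ^ k ≤ b)
    (hbW : b ≤ W ^ (k + 1)) :
    W ^ 4 ≤ X / (m * (a * b)) ∧ X / (m * (a * b)) ≤ W ^ 23 ∧
      X < 2 * (m * (a * b)) * (X / (m * (a * b))) := by
  have hw1 : 1 ≤ w := Nat.one_le_two_pow.trans hw
  have hW1 : 1 ≤ W := hW ▸ Nat.one_le_pow _ _ hw1
  have hb0 : 0 < b := (Nat.pow_pos hW1).trans_le hb
  have hM : 0 < m * (a * b) := by positivity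
  have hWE : W ^ (k + 22) = w ^ E := by rw [hW, hE, ← pow_mul]
  have h1 : W ^ 4 ≤ X / (m * (a * b)) := by
    rw [Nat.le_div_iff_mul_le hM]
    calc W ^ 4 * (m * (a * b)) ≤ W ^ 4 * (W * (W ^ 16 * W ^ (k + 1))) :=
          Nat.mul_le_mul_left _ (Nat.mul_le_mul hmW (Nat.mul_le_mul haW hbW))
      _ = W ^ (k + 22) := by ring
      _ = w ^ E := hWE
      _ ≤ X := hX
  refine ⟨h1, ?_, ?_⟩
  · refine Nat.div_le_of_le_mul ?_
    have h2 : w ≤ W := hW ▸ Nat.le_self_pow (by positivity) w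
    calc X ≤ (w + 1) ^ E := hX'.le
      _ ≤ (2 * w) ^ E := Nat.pow_le_pow_left (by omega) E
      _ = 2 ^ E * w ^ E := mul_pow _ _ _
      _ ≤ W * W ^ (k + 22) := by
        rw [hWE]
        exact Nat.mul_le_mul_right _ (hw.trans h2)
      _ = 1 * (1 * W ^ k) * W ^ 23 := by ring
      _ ≤ m * (a * b) * W ^ 23 :=
        Nat.mul_le_mul_right _ (Nat.mul_le_mul hm (Nat.mul_le_mul ha hb))
  · have h2 : 1 ≤ X / (m * (a * b)) := (Nat.one_le_pow _ _ hW1).trans h1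
    have h3 : X < m * (a * b) * (X / (m * (a * b)) + 1) := Nat.lt_mul_div_succ X hM
    calc X < m * (a * b) * (X / (m * (a * b)) + 1) := h3
      _ ≤ m * (a * b) * (2 * (X / (m * (a * b)))) := Nat.mul_le_mul_left _ (by omega)
      _ = _ := by ring

lemma exists_add_le_lt_succ {y : ℕ → ℕ} {K W : ℕ} (hK : y K ≤ W) (hy : ∃ j, W < y j)
    (hmono : Monotone y) : ∃ J, y (J + K) ≤ W ∧ W < y (J + K + 1) := by
  have h1 := Nat.find_spec hy
  have h2 : K < Nat.find hy := by
    by_contra! h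
    exact ((h1.trans_le (hmono h)).trans_le hK).false
  refine ⟨Nat.find hy - 1 - K, ?_, ?_⟩
  · exact not_lt.1 (Nat.find_min hy (by omega))
  · rwa [show Nat.find hy - 1 - K + K + 1 = Nat.find hy by omega]

lemma card_hitBy_le_card_filter_dvd {I U : Finset ℕ} {n : ℕ} (hn : n ≠ 0)
    (hU : ∀ p ∈ U, p.Prime ∧ p ∣ n) :
    (hitBy I U).card ≤ (I.filter (· ∣ carmichael n)).card := by
  refine Finset.card_le_card fun q hq => ?_
  rw [hitBy, Finset.mem_filter] at hq
  obtain ⟨hqI, p, hp, hqp⟩ := hq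
  exact Finset.mem_filter.2
    ⟨hqI, hqp.trans (sub_one_dvd_carmichael (hU p hp).1 (hU p hp).2 hn)⟩

lemma le_card_primesIoc_of_bounds {T0 T W X m : ℕ} {U V : Finset ℕ}
    (hT0 : ∀ T M : ℕ, T0 ≤ T → M ^ 2 ≤ T → (T:ℝ) / (4 * Real.log T) ≤ (primesIoc M T).card)
    (hW : 2 ≤ W) (hTW : T0 ≤ W) (hm : 0 < m) (hU : ∀ p ∈ U, 0 < p) (hV : ∀ p ∈ V, 0 < p)
    (h4 : W ^ 4 ≤ T) (h23 : T ≤ W ^ 23)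
    (hX : X < 2 * (m * ((∏ q ∈ U, q) * ∏ q ∈ V, q)) * T) :
    (X:ℝ) / (184 * m * Real.log W) * ((∏ q ∈ U, 1 / (q:ℝ)) * ∏ q ∈ V, 1 / (q:ℝ)) ≤
      (primesIoc (W ^ 2) T).card := by
  have hW4 : W ≤ W ^ 4 := Nat.le_self_pow (by norm_num) W
  refine le_trans ?_ (hT0 T (W ^ 2) (hTW.trans (hW4.trans h4)) (by rwa [← pow_mul]))
  have hT2 : 2 ≤ T := hW.trans (hW4.trans h4)
  have hlogT : Real.log T ≤ 23 * Real.log W := by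
    have h : Real.log T ≤ Real.log ((W ^ 23 : ℕ) : ℝ) :=
      Real.log_le_log (by exact_mod_cast (by omega : 0 < T)) (by exact_mod_cast h23)
    rwa [Nat.cast_pow, Real.log_pow] at h
  have hlogT0 : 0 < Real.log T := Real.log_pos (by exact_mod_cast hT2)
  have hlogW0 : 0 < Real.log W := Real.log_pos (by exact_mod_cast hW)
  obtain ⟨a, ha⟩ : ∃ a, a = ∏ q ∈ U, q := ⟨_, rfl⟩
  obtain ⟨b, hb⟩ : ∃ b, b = ∏ q ∈ V, q := ⟨_, rfl⟩
  have ha0 : (0:ℝ) < a := by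
    rw [ha]
    exact_mod_cast Finset.prod_pos hU
  have hb0 : (0:ℝ) < b := by
    rw [hb]
    exact_mod_cast Finset.prod_pos hV
  have hm0 : (0:ℝ) < m := by exact_mod_cast hm
  have ha' : ∏ q ∈ U, 1 / (q:ℝ) = 1 / a := by
    rw [ha, Nat.cast_prod, Finset.prod_div_distrib, Finset.prod_const_one]
  have hb' : ∏ q ∈ V, 1 / (q:ℝ) = 1 / b := by
    rw [hb, Nat.cast_prod, Finset.prod_div_distrib, Finset.prod_const_one]
  rw [ha', hb']
  rw [← ha, ← hb] at hX
  have hX' : (X:ℝ) ≤ 2 * (m * (a * b)) * T := by exact_mod_cast hX.le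
  calc (X:ℝ) / (184 * m * Real.log W) * (1 / a * (1 / b))
      = X / (2 * (m * (a * b))) / (4 * (23 * Real.log W)) := by
        field_simp
        ring
    _ ≤ T / (4 * Real.log T) := by
        refine div_le_div₀ (Nat.cast_nonneg T) ?_ (by linarith) (by linarith)
        rw [div_le_iff₀ (by positivity)]
        linarith

theorem exists_le_card_denseDivIn (h : ℕ) (hh : 0 < h) :
    ∃ c : ℝ, 0 < c ∧ ∃ X0 : ℕ, ∀ X, X0 ≤ X →
      c * X ≤ (((Finset.Icc 1 X).filter
        (fun n =>
          DenseDivIn (Nat.totient n) (1 + 1 / h)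
            (Set.Ico (h : ℝ) ((Nat.totient n : ℝ) / (h + 1))) ∧
          DenseDivIn (carmichael n) (1 + 1 / h)
            (Set.Ico (h : ℝ) ((carmichael n : ℝ) / (h + 1))))).card : ℝ) := by
  obtain ⟨R, K, Y0, hR, hK, hF⟩ := exists_log_div_four_le_sum_richSets
  obtain ⟨k, hkR⟩ : ∃ k, k = 23 * R ^ (K + 1) := ⟨_, rfl⟩
  have hk : 0 < k := by
    rw [hkR]
    positivity
  obtain ⟨c, hc, w0, hw0, hI⟩ := exists_le_sum_layered k hk
  obtain ⟨T0, hT02, hT0⟩ := exists_le_card_primesIoc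
  obtain ⟨Y, hY⟩ : ∃ Y, Y = max (max Y0 k) (2 * h) := ⟨_, rfl⟩
  have hYY0 : Y0 ≤ Y := hY ▸ (le_max_left _ _).trans (le_max_left _ _)
  have hYk : k ≤ Y := hY ▸ (le_max_right _ _).trans (le_max_left _ _)
  have hYh : 2 * h ≤ Y := hY ▸ le_max_right _ _
  clear hY
  have hY2 : 2 ≤ Y := by omega
  obtain ⟨hmert, hrich⟩ := hF Y hYY0
  obtain ⟨Q, hQY, hQ0, hQp, hQ⟩ := exists_denseDivIn_base hh (h * (h + 1) * Y ^ R)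
  obtain ⟨m, hm, -, hmQ⟩ := Nat.exists_prime_gt_modEq_one 1 hQ0.ne'
  obtain ⟨E, hE⟩ : ∃ E, E = k ^ 2 * (k + 22) := ⟨_, rfl⟩
  have hE0 : E ≠ 0 := by
    rw [hE]
    positivity
  obtain ⟨w1, hw1⟩ : ∃ w1, w1 = max (max (max w0 T0) (max (2 ^ E) m)) (Y ^ R ^ K) := ⟨_, rfl⟩
  have hm0 : (0:ℝ) < m := by exact_mod_cast hm.pos
  refine ⟨c / (736 * m), by positivity, w1 ^ E, fun X hX => ?_⟩
  obtain ⟨w, hwX, hXw⟩ := exists_pow_le_lt_succ_pow hE0 X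
  have hw : w1 ≤ w := by
    by_contra! hlt
    exact ((hX.trans_lt hXw).trans_le (Nat.pow_le_pow_left hlt E)).false
  rw [hw1] at hw
  clear hw1 hX w1
  simp only [max_le_iff] at hw
  obtain ⟨⟨⟨hww0, hwT0⟩, hwE, hwm⟩, hwY⟩ := hw
  have hw2 : 2 ≤ w := hw0.trans hww0
  obtain ⟨W, hW⟩ : ∃ W, W = w ^ k ^ 2 := ⟨_, rfl⟩
  have hwW : w ≤ W := hW ▸ Nat.le_self_pow (by positivity) w
  have hY0 : 0 < Y := by omega
  have hymono : Monotone fun j => Y ^ R ^ j := fun i j hij =>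
    Nat.pow_le_pow_right hY0 (Nat.pow_le_pow_right (by omega) hij)
  obtain ⟨J, hJ, hJ'⟩ := exists_add_le_lt_succ (y := fun j => Y ^ R ^ j) (hwY.trans hwW)
    ⟨W, (Nat.lt_pow_self (by omega : 1 < R)).trans (Nat.lt_pow_self (by omega : 1 < Y))⟩ hymono
  have hyY : ∀ i, Y ≤ Y ^ R ^ i := fun i => Nat.le_self_pow (by positivity) Y
  have hJ20 : (Y ^ R ^ (J + 1)) ^ 20 ≤ W := by
    refine le_trans ?_ hJ
    rw [← pow_mul]
    refine Nat.pow_le_pow_right hY0 ?_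
    calc R ^ (J + 1) * 20 ≤ R ^ (J + 1) * 2 ^ 5 := Nat.mul_le_mul_left _ (by norm_num)
      _ ≤ R ^ (J + 1) * R ^ 5 := Nat.mul_le_mul_left _ (Nat.pow_le_pow_left hR 5)
      _ = R ^ (J + 6) := by rw [← pow_add]
      _ ≤ R ^ (J + K) := Nat.pow_le_pow_right (by omega) (by omega)
  have hW23 : W ^ 23 ≤ (Y ^ R ^ J) ^ k := by
    calc W ^ 23 ≤ (Y ^ R ^ (J + K + 1)) ^ 23 := Nat.pow_le_pow_left hJ'.le 23
      _ = (Y ^ R ^ J) ^ k := by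
        rw [hkR, ← pow_mul, ← pow_mul]
        congr 1
        ring
  obtain ⟨𝒱, h𝒱, h𝒱c⟩ := hI w hww0 (primesIoc (Y ^ R ^ J) (Y ^ R ^ (J + 1))) (fun q hq => by
    obtain ⟨⟨h1, h2⟩, h3⟩ := mem_primesIoc.1 hq
    have h4 := (hyY J).trans_lt h1
    exact ⟨h3, hY2.trans_lt h4, hYk.trans h4.le,
      (Nat.pow_le_pow_left h2 20).trans (hJ20.trans_eq hW)⟩) (hmert J)
  have hU := hrich J W hJ
  obtain ⟨𝒰, h𝒰⟩ : ∃ 𝒰, 𝒰 = richSets (fun i => Y ^ R ^ i) (R ^ 2 + 1) J W := ⟨_, rfl⟩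
  rw [← h𝒰] at hU
  have h𝒰m : ∀ U ∈ 𝒰, (∀ p ∈ U, p.Prime ∧ p ≤ W) ∧ ∏ p ∈ U, p ≤ W ^ 16 ∧
      ∀ i < J, R ^ 2 + 1 ≤ (hitBy (primesIoc (Y ^ R ^ i) (Y ^ R ^ (i + 1))) U).card := by
    intro U hUU
    rw [h𝒰, richSets, Finset.mem_filter, Finset.mem_powerset] at hUU
    refine ⟨fun p hp => ?_, hUU.2⟩
    have := mem_primesIoc.1 (hUU.1 hp)
    exact ⟨this.2, this.1.2⟩
  have hup : w ^ (k ^ 2 + k) ≤ W ^ 2 := by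
    rw [hW, ← pow_mul]
    refine Nat.pow_le_pow_right (by omega) ?_
    nlinarith
  have hWW2 : W ≤ W ^ 2 := Nat.le_self_pow two_ne_zero W
  have h𝒱m : ∀ V ∈ 𝒱, ∀ p ∈ V, p.Prime ∧ W < p ∧ p ≤ W ^ 2 := fun V hV p hp =>
    ⟨((h𝒱 V hV).2.2 p hp).1, hW ▸ ((h𝒱 V hV).2.2 p hp).2.1,
      ((h𝒱 V hV).2.2 p hp).2.2.trans hup⟩
  have hbounds : ∀ U ∈ 𝒰, ∀ V ∈ 𝒱, W ^ 4 ≤ X / (m * ((∏ q ∈ U, q) * ∏ q ∈ V, q)) ∧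
      X / (m * ((∏ q ∈ U, q) * ∏ q ∈ V, q)) ≤ W ^ 23 ∧
      X < 2 * (m * ((∏ q ∈ U, q) * ∏ q ∈ V, q)) *
        (X / (m * ((∏ q ∈ U, q) * ∏ q ∈ V, q))) := by
    intro U hUU V hVV
    refine div_bounds_of_pow_bounds hk hW hE hwE hwX hXw hm.pos (hwm.trans hwW)
      (Finset.prod_pos fun p hp => ((h𝒰m U hUU).1 p hp).1.pos) (h𝒰m U hUU).2.1 ?_ ?_
    · exact pow_le_prod_of_le_card (by omega) (fun q hq => (h𝒱m V hVV q hq).2.1.le)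
        (h𝒱 V hVV).1.ge
    · refine (Finset.prod_le_pow_card V _ (w ^ (k ^ 2 + k))
        fun p hp => ((h𝒱 V hVV).2.2 p hp).2.2).trans_eq ?_
      rw [(h𝒱 V hVV).1, hW, ← pow_mul, ← pow_mul]
      congr 1
      ring
  have hmain := le_card_filter_of_le_card_primesIoc (𝒰 := 𝒰) (𝒱 := 𝒱) (m := m) (X := X) (W := W)
    (M := W ^ 2) (δ := (X:ℝ) / (184 * m * Real.log W))
    (fun n =>
      DenseDivIn (Nat.totient n) (1 + 1 / h)
        (Set.Ico (h : ℝ) ((Nat.totient n : ℝ) / (h + 1))) ∧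
      DenseDivIn (carmichael n) (1 + 1 / h)
        (Set.Ico (h : ℝ) ((carmichael n : ℝ) / (h + 1)))) hm.pos
    (fun U hUU => (h𝒰m U hUU).1) h𝒱m hWW2 ?_ ?_
  · refine le_trans ?_ hmain
    have hlogW : 0 < Real.log W := Real.log_pos (by exact_mod_cast (by omega : 1 < W))
    calc c / (736 * m) * X = X / (184 * m * Real.log W) * (Real.log W / 4 * c) := by
          field_simp
          ring
      _ ≤ _ := mul_le_mul_of_nonneg_left (mul_le_mul hU h𝒱c hc.le ((by positivity :
            0 ≤ Real.log W / 4).trans hU)) (by positivity)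
  · intro U hUU V hVV p hp
    obtain ⟨h4, h23, -⟩ := hbounds U hUU V hVV
    obtain ⟨⟨hp1, hp2⟩, hpp⟩ := mem_primesIoc.1 hp
    obtain ⟨n, hn⟩ : ∃ n, n = m * ((∏ q ∈ U, q) * ∏ q ∈ V, q) * p := ⟨_, rfl⟩
    have hUn : ∀ q ∈ U, q.Prime ∧ q ∣ n := fun q hq => ⟨((h𝒰m U hUU).1 q hq).1,
      hn ▸ (((Finset.dvd_prod_of_mem _ hq).mul_right _).mul_left _).mul_right _⟩
    have hVn : ∀ q ∈ V, q.Prime ∧ q ∣ n := fun q hq => ⟨(h𝒱m V hVV q hq).1,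
      hn ▸ (((Finset.dvd_prod_of_mem _ hq).mul_left _).mul_left _).mul_right _⟩
    have hn0 : n ≠ 0 := by
      rw [hn]
      refine mul_ne_zero (mul_ne_zero hm.ne_zero (mul_ne_zero ?_ ?_)) hpp.ne_zero
      · exact Finset.prod_ne_zero_iff.2 fun q hq => (hUn q hq).1.ne_zero
      · exact Finset.prod_ne_zero_iff.2 fun q hq => (hVn q hq).1.ne_zero
    have hmn : m ∣ n := hn ▸ Dvd.intro _ (mul_assoc _ _ _).symm
    have hQm : Q ∣ m - 1 := (Nat.modEq_iff_dvd' hm.one_lt.le).1 hmQ.symm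
    rw [← hn]
    refine denseDivIn_of_divisors (B := W ^ 23) hh hR hQY
      (fun q hq hqQ => (hQp q hq hqQ).trans hYh) hQ hY2 hn0
      (hQm.trans (sub_one_dvd_carmichael hm hmn hn0))
      (fun i hi => ((h𝒰m U hUU).2.2 i hi).trans (card_hitBy_le_card_filter_dvd hn0 hUn))
      ((h𝒱 V hVV).2.1.trans (card_hitBy_le_card_filter_dvd hn0 hVn)) ?_ hW23
    have hWle : W ≤ W ^ 23 := Nat.le_self_pow (by norm_num) W
    intro q hq hqn
    rw [hn] at hqn
    rcases hq.dvd_mul.1 hqn with hqn | hqn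
    · rcases hq.dvd_mul.1 hqn with hqn | hqn
      · exact (Nat.le_of_dvd hm.pos hqn).trans ((hwm.trans hwW).trans hWle)
      · rcases hq.dvd_mul.1 hqn with hqn | hqn
        · obtain ⟨r, hr, hqr⟩ := (hq.prime.dvd_finsetProd_iff _).1 hqn
          have hr' := (h𝒰m U hUU).1 r hr
          exact (Nat.le_of_dvd hr'.1.pos hqr).trans (hr'.2.trans hWle)
        · obtain ⟨r, hr, hqr⟩ := (hq.prime.dvd_finsetProd_iff _).1 hqn
          have hr' := h𝒱m V hVV r hr
          exact (Nat.le_of_dvd hr'.1.pos hqr).trans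
            (hr'.2.2.trans (Nat.pow_le_pow_right (by omega) (by norm_num)))
    · exact (Nat.le_of_dvd hpp.pos hqn).trans (hp2.trans h23)
  · intro U hUU V hVV
    obtain ⟨h4, h23, hlt⟩ := hbounds U hUU V hVV
    exact le_card_primesIoc_of_bounds hT0 (hw2.trans hwW) (hwT0.trans hwW) hm.pos
      (fun p hp => ((h𝒰m U hUU).1 p hp).1.pos) (fun p hp => (h𝒱m V hVV p hp).1.pos) h4 h23 hlt

theorem stmt_8 (h : ℕ) (hh : 0 < h) :
    ∃ c : ℝ, 0 < c ∧ ∀ᶠ x : ℝ in atTop,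
      c * x ≤ (((Finset.Icc 1 ⌊x⌋₊).filter
        (fun n =>
          DenseDivIn (Nat.totient n) (1 + 1 / h)
            (Set.Ico (h : ℝ) ((Nat.totient n : ℝ) / (h + 1))) ∧
          DenseDivIn (carmichael n) (1 + 1 / h)
            (Set.Ico (h : ℝ) ((carmichael n : ℝ) / (h + 1))))).card : ℝ) := by
  obtain ⟨c, hc, X0, H⟩ := exists_le_card_denseDivIn h hh
  refine ⟨c / 2, by positivity, ?_⟩
  filter_upwards [eventually_ge_atTop (max (X0:ℝ) 2)] with x hx
  rw [max_le_iff] at hx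
  refine le_trans ?_ (H ⌊x⌋₊ (Nat.le_floor hx.1))
  have h1 := Nat.lt_floor_add_one x
  nlinarith
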